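/- arXiv:2312.15262 — 2 statements merged into one kernel-verified Lean document; each statement's English description precedes it below -/
import Mathlib

section
/- For all integers k ≥ 2 and s_0 with s_0 ≥ 5k, there are C > 0 and s_1 ≥ s_0 such that the following holds. Suppose G is an n-vertex k-graph such that for each s with s_0 ≤ s ≤ s_1 and k dividing s, the property s-graph P = P_{G, mat_k, s} satisfies δ_1(P) ≥ (1 − s^{−2})·binom(n−1, s−1). Then the random sparsification G_p contains a perfect matching with high probability, whenever p ≥ C·n^{−k+1}·log n and k divides n. -/
/-- `G` is a `k`-uniform hypergraph on vertex set `Fin n`. -/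
def IsHG (k n : ℕ) (G : Finset (Finset (Fin n))) : Prop := ∀ e ∈ G, e.card = k

open Classical in
/-- Probability that the random sparsification of `G` (each edge kept
independently with probability `p`) satisfies `Q`. -/
noncomputable def sparsProb {α : Type*} [DecidableEq α] (G : Finset α) (p : ℝ)
    (Q : Finset α → Prop) : ℝ :=
  ∑ E ∈ G.powerset, if Q E then p ^ E.card * (1 - p) ^ (G.card - E.card) else 0

/-- The edge set `E` contains a perfect matching of the vertex set `S`:
pairwise disjoint edges inside `S` covering all of `S`. -/
def HasPM {n : ℕ} (S : Finset (Fin n)) (E : Finset (Finset (Fin n))) : Prop :=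
  ∃ M : Finset (Finset (Fin n)), M ⊆ E ∧ (∀ e ∈ M, e ⊆ S) ∧
    (∀ e ∈ M, ∀ f ∈ M, e ≠ f → Disjoint e f) ∧ ∀ v ∈ S, ∃ e ∈ M, v ∈ e

/-- Expectation of `f` over the random subset of `X` that keeps each element independently with
probability `p`. -/
noncomputable def bernExp {α : Type*} [DecidableEq α] (X : Finset α) (p : ℝ)
    (f : Finset α → ℝ) : ℝ :=
  ∑ W ∈ X.powerset, p ^ W.card * (1 - p) ^ (X.card - W.card) * f W

section Bernoulli

variable {α : Type*} [DecidableEq α]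

lemma bernExp_insert {X : Finset α} {x : α} (hx : x ∉ X) (p : ℝ) (f : Finset α → ℝ) :
    bernExp (insert x X) p f =
      (1 - p) * bernExp X p f + p * bernExp X p (fun W => f (insert x W)) := by
  unfold bernExp
  rw [Finset.sum_powerset_insert hx, Finset.mul_sum, Finset.mul_sum]
  congr 1
  · refine Finset.sum_congr rfl fun W hW => ?_
    have h1 := Finset.card_le_card (Finset.mem_powerset.1 hW)
    rw [Finset.card_insert_of_notMem hx, Nat.succ_sub h1, pow_succ]
    ring
  · refine Finset.sum_congr rfl fun W hW => ?_
    have hxW : x ∉ W := fun h => hx (Finset.mem_powerset.1 hW h)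
    rw [Finset.card_insert_of_notMem hx, Finset.card_insert_of_notMem hxW, pow_succ,
      Nat.add_sub_add_right]
    ring

lemma bernExp_add (X : Finset α) (p : ℝ) (f g : Finset α → ℝ) :
    bernExp X p (fun W => f W + g W) = bernExp X p f + bernExp X p g := by
  simp only [bernExp, mul_add, Finset.sum_add_distrib]

lemma bernExp_const_mul (X : Finset α) (p c : ℝ) (f : Finset α → ℝ) :
    bernExp X p (fun W => c * f W) = c * bernExp X p f := by
  simp only [bernExp, Finset.mul_sum]
  exact Finset.sum_congr rfl fun _ _ => by ring

lemma bernExp_const (X : Finset α) (p c : ℝ) : bernExp X p (fun _ => c) = c := by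
  induction X using Finset.induction_on with
  | empty => simp [bernExp]
  | insert x X hx ih => rw [bernExp_insert hx, ih]; ring

lemma bernExp_mono {X : Finset α} {p : ℝ} (hp0 : 0 ≤ p) (hp1 : p ≤ 1) {f g : Finset α → ℝ}
    (h : ∀ W ⊆ X, f W ≤ g W) : bernExp X p f ≤ bernExp X p g :=
  Finset.sum_le_sum fun W hW => mul_le_mul_of_nonneg_left (h W (Finset.mem_powerset.1 hW))
    (mul_nonneg (pow_nonneg hp0 _) (pow_nonneg (by linarith) _))

lemma bernExp_union (X : Finset α) (p₁ p₂ : ℝ) (f : Finset α → ℝ) :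
    bernExp X p₁ (fun W₁ => bernExp X p₂ (fun W₂ => f (W₁ ∪ W₂))) =
      bernExp X (p₁ + p₂ - p₁ * p₂) f := by
  induction X using Finset.induction_on generalizing f with
  | empty => simp [bernExp]
  | insert x X hx ih =>
    simp only [bernExp_insert hx, Finset.insert_union, Finset.union_insert,
      bernExp_add, bernExp_const_mul, Finset.insert_idem]
    rw [ih f, ih (fun W => f (insert x W))]
    ring

lemma bernExp_anti {X : Finset α} {p p' : ℝ} (hp0 : 0 ≤ p) (h : p ≤ p') (hp1 : p' ≤ 1)
    {f : Finset α → ℝ} (hf : ∀ W W', W ⊆ W' → f W' ≤ f W) :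
    bernExp X p' f ≤ bernExp X p f := by
  rcases eq_or_lt_of_le (h.trans hp1) with h1 | h1
  · rw [show p' = p by linarith]
  · have hpos : 0 < 1 - p := by linarith
    have e : p' = p + (p' - p) / (1 - p) - p * ((p' - p) / (1 - p)) := by
      field_simp
      ring
    rw [e, ← bernExp_union]
    refine bernExp_mono hp0 h1.le fun W _ => ?_
    calc bernExp X ((p' - p) / (1 - p)) (fun W₂ => f (W ∪ W₂))
        ≤ bernExp X ((p' - p) / (1 - p)) (fun _ => f W) :=
          bernExp_mono (div_nonneg (by linarith) hpos.le)
            ((div_le_one hpos).2 (by linarith)) fun W₂ _ => hf _ _ Finset.subset_union_left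
      _ = f W := bernExp_const _ _ _

/-- The inclusion-minimal sets among `S \ W`, `S ∈ H`. -/
def minFrag (H : Finset (Finset α)) (W : Finset α) : Finset (Finset α) :=
  (H.image (· \ W)).filter fun U => ∀ S ∈ H, S \ W ⊆ U → S \ W = U

/-- Every member of `H` contains a member of `𝒢`. -/
def IsCover (𝒢 H : Finset (Finset α)) : Prop := ∀ S ∈ H, ∃ U ∈ 𝒢, U ⊆ S

lemma isCover_minFrag (H : Finset (Finset α)) (W : Finset α) : IsCover (minFrag H W) H := by
  intro S hS
  obtain ⟨U, hU, hmin⟩ := (H.image (· \ W)).exists_le_minimal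
    (Finset.mem_image_of_mem (· \ W) hS)
  refine ⟨U, Finset.mem_filter.2 ⟨hmin.1, fun S' hS' h => ?_⟩, hU.trans Finset.sdiff_subset⟩
  exact le_antisymm h (hmin.2 (Finset.mem_image_of_mem (· \ W) hS') h)

lemma exists_of_mem_minFrag {H : Finset (Finset α)} {W U : Finset α} (h : U ∈ minFrag H W) :
    ∃ S ∈ H, S \ W = U :=
  Finset.mem_image.1 (Finset.mem_filter.1 h).1

lemma subset_of_mem_minFrag {H : Finset (Finset α)} {W U S : Finset α} (h : U ∈ minFrag H W)
    (hS : S ∈ H) (hSU : S ⊆ W ∪ U) : U ⊆ S := by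
  have h1 : S \ W ⊆ U := by
    intro x hx
    rw [Finset.mem_sdiff] at hx
    exact (Finset.mem_union.1 (hSU hx.1)).resolve_left hx.2
  rw [← (Finset.mem_filter.1 h).2 S hS h1]
  exact Finset.sdiff_subset

/-- The expected cost of the large minimal fragments is small. -/
lemma bernExp_cost_le {X : Finset α} {H : Finset (Finset α)} {ℓ m : ℕ} {p q x : ℝ}
    (hX : ∀ S ∈ H, S ⊆ X) (hℓ : ∀ S ∈ H, S.card ≤ ℓ) (hq : 0 ≤ q) (hp0 : 0 ≤ p) (hp1 : p ≤ 1)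
    (hx0 : 0 ≤ x) (hx1 : x ≤ 1) (hqx : q ≤ p * x) :
    bernExp X p (fun W => ∑ U ∈ (minFrag H W).filter (fun U => m ≤ U.card), q ^ U.card) ≤
      2 ^ ℓ * x ^ m := by
  classical
  let sel : Finset α → Finset α := fun Z => if h : ∃ S ∈ H, S ⊆ Z then h.choose else ∅
  have hsel_card : ∀ Z, (sel Z).card ≤ ℓ := by
    intro Z
    by_cases h : ∃ S ∈ H, S ⊆ Z
    · simp only [sel, dif_pos h]; exact hℓ _ h.choose_spec.1
    · simp [sel, dif_neg h]
  have h1p : 0 ≤ 1 - p := by linarith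
  have key : bernExp X p
        (fun W => ∑ U ∈ (minFrag H W).filter (fun U => m ≤ U.card), q ^ U.card) ≤
      bernExp X p (fun Z => ∑ U ∈ (sel Z).powerset.filter (fun U => m ≤ U.card), x ^ U.card) := by
    unfold bernExp
    simp only [Finset.mul_sum]
    rw [Finset.sum_sigma', Finset.sum_sigma']
    have hmem : ∀ a ∈ X.powerset.sigma fun W => (minFrag H W).filter (fun U => m ≤ U.card),
        a.1 ⊆ X ∧ a.2 ⊆ X ∧ Disjoint a.1 a.2 ∧ a.2 ∈ minFrag H a.1 ∧ m ≤ a.2.card ∧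
        a.2 ⊆ sel (a.1 ∪ a.2) := by
      rintro ⟨W, U⟩ ha
      simp only [Finset.mem_sigma, Finset.mem_powerset, Finset.mem_filter] at ha
      obtain ⟨S, hS, hSU⟩ := exists_of_mem_minFrag ha.2.1
      have hex : ∃ S ∈ H, S ⊆ W ∪ U := ⟨S, hS, by rw [← hSU]; simp⟩
      refine ⟨ha.1, ?_, ?_, ha.2.1, ha.2.2, ?_⟩
      · rw [← hSU]; exact Finset.sdiff_subset.trans (hX S hS)
      · rw [← hSU]; exact Finset.disjoint_sdiff
      · simp only [sel, dif_pos hex]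
        exact subset_of_mem_minFrag ha.2.1 hex.choose_spec.1 hex.choose_spec.2
    let φ : (Σ _ : Finset α, Finset α) → (Σ _ : Finset α, Finset α) := fun a => ⟨a.1 ∪ a.2, a.2⟩
    have hinj : Set.InjOn φ
        (X.powerset.sigma fun W => (minFrag H W).filter (fun U => m ≤ U.card)) := by
      rintro ⟨W, U⟩ ha ⟨W', U'⟩ hb h
      simp only [φ, Sigma.mk.injEq, heq_eq_eq] at h
      obtain ⟨h1, rfl⟩ := h
      have d1 : Disjoint W U := (hmem _ ha).2.2.1
      have d2 : Disjoint W' U := (hmem _ hb).2.2.1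
      have : W = W' := by
        rw [← Finset.union_sdiff_cancel_right d1, ← Finset.union_sdiff_cancel_right d2, h1]
      rw [this]
    calc _ ≤ ∑ a ∈ X.powerset.sigma fun W => (minFrag H W).filter (fun U => m ≤ U.card),
          p ^ (φ a).1.card * (1 - p) ^ (X.card - (φ a).1.card) * x ^ (φ a).2.card := by
            refine Finset.sum_le_sum fun a ha => ?_
            obtain ⟨_, _, hd, _⟩ := hmem a ha
            simp only [φ]
            rw [Finset.card_union_of_disjoint hd]
            calc p ^ a.1.card * (1 - p) ^ (X.card - a.1.card) * q ^ a.2.card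
                ≤ p ^ a.1.card * (1 - p) ^ (X.card - (a.1.card + a.2.card)) *
                  (p * x) ^ a.2.card := by
                  have e1 := pow_le_pow_of_le_one h1p (by linarith : 1 - p ≤ 1)
                    (show X.card - (a.1.card + a.2.card) ≤ X.card - a.1.card by omega)
                  have e2 := pow_le_pow_left₀ hq hqx a.2.card
                  gcongr
              _ = _ := by rw [mul_pow, pow_add]; ring
      _ = ∑ b ∈ (X.powerset.sigma fun W =>
            (minFrag H W).filter (fun U => m ≤ U.card)).image φ,
          p ^ b.1.card * (1 - p) ^ (X.card - b.1.card) * x ^ b.2.card :=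
            (Finset.sum_image (f := fun b : (Σ _ : Finset α, Finset α) =>
              p ^ b.1.card * (1 - p) ^ (X.card - b.1.card) * x ^ b.2.card) hinj).symm
      _ ≤ _ := by
            refine Finset.sum_le_sum_of_subset_of_nonneg ?_ fun b _ _ => by positivity
            intro b hb
            obtain ⟨a, ha, rfl⟩ := Finset.mem_image.1 hb
            obtain ⟨h1, h2, h3, h4, h5, h6⟩ := hmem a ha
            simp only [φ, Finset.mem_sigma, Finset.mem_powerset, Finset.mem_filter]
            exact ⟨Finset.union_subset h1 h2, h6, h5⟩
  refine key.trans ?_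
  calc _ ≤ bernExp X p (fun _ => 2 ^ ℓ * x ^ m) := by
        refine bernExp_mono hp0 hp1 fun Z _ => ?_
        calc ∑ U ∈ (sel Z).powerset.filter (fun U => m ≤ U.card), x ^ U.card
            ≤ ∑ U ∈ (sel Z).powerset.filter (fun U => m ≤ U.card), x ^ m :=
              Finset.sum_le_sum fun U hU =>
                pow_le_pow_of_le_one hx0 hx1 (Finset.mem_filter.1 hU).2
          _ ≤ ∑ U ∈ (sel Z).powerset, x ^ m :=
              Finset.sum_le_sum_of_subset_of_nonneg (Finset.filter_subset _ _)
                fun _ _ _ => by positivity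
          _ = 2 ^ (sel Z).card * x ^ m := by simp [Finset.card_powerset]
          _ ≤ 2 ^ ℓ * x ^ m := by
              gcongr
              · norm_num
              · exact hsel_card Z
    _ = _ := bernExp_const _ _ _

open Classical in
/-- Indicator of the event that `W` contains no member of `H`. -/
noncomputable def missInd (H : Finset (Finset α)) (W : Finset α) : ℝ :=
  if ∃ S ∈ H, S ⊆ W then 0 else 1

lemma missInd_nonneg (H : Finset (Finset α)) (W : Finset α) : 0 ≤ missInd H W := by
  unfold missInd; split_ifs <;> norm_num

lemma missInd_le_one (H : Finset (Finset α)) (W : Finset α) : missInd H W ≤ 1 := by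
  unfold missInd; split_ifs <;> norm_num

lemma missInd_anti (H : Finset (Finset α)) {W W' : Finset α} (h : W ⊆ W') :
    missInd H W' ≤ missInd H W := by
  unfold missInd
  split_ifs with h1 h2 h2 <;> try norm_num
  obtain ⟨S, hS, hSW⟩ := h2
  exact h1 ⟨S, hS, hSW.trans h⟩

lemma cost_mul_miss_le_of_last {X : Finset α} {H : Finset (Finset α)} {ℓ : ℕ} {p q x c : ℝ}
    (hX : ∀ S ∈ H, S ⊆ X) (hℓ : ∀ S ∈ H, S.card ≤ ℓ) (hq : 0 ≤ q) (hp0 : 0 ≤ p) (hp1 : p ≤ 1)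
    (hx0 : 0 ≤ x) (hx1 : x ≤ 1) (hqx : q ≤ p * x)
    (hc : ∀ 𝒢, IsCover 𝒢 H → c ≤ ∑ U ∈ 𝒢, q ^ U.card) :
    c * bernExp X p (missInd H) ≤ 2 ^ ℓ * x := by
  rw [← bernExp_const_mul]
  refine le_trans ?_ ((bernExp_cost_le (m := 1) hX hℓ hq hp0 hp1 hx0 hx1 hqx).trans_eq
    (by rw [pow_one]))
  refine bernExp_mono hp0 hp1 fun W _ => ?_
  unfold missInd
  split_ifs with h
  · rw [mul_zero]
    exact Finset.sum_nonneg fun _ _ => pow_nonneg hq _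
  · rw [mul_one]
    have : (minFrag H W).filter (fun U => 1 ≤ U.card) = minFrag H W := by
      refine Finset.filter_true_of_mem fun U hU => ?_
      obtain ⟨S, hS, rfl⟩ := exists_of_mem_minFrag hU
      refine Nat.succ_le_of_lt (Finset.card_pos.2 ?_)
      rw [Finset.sdiff_nonempty]
      exact fun h' => h ⟨S, hS, h'⟩
    rw [this]
    exact hc _ (isCover_minFrag H W)

/-- Success probability after `J` rounds of density `64 q` preceded by one of density `L q`. -/
noncomputable def roundProb (q L : ℝ) : ℕ → ℝ
  | 0 => L * q
  | J + 1 => 64 * q + roundProb q L J - 64 * q * roundProb q L J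

lemma roundProb_bounds {q L : ℝ} (hq : 0 ≤ q) (hL : 0 ≤ L) (J : ℕ)
    (h : (64 * J + L) * q ≤ 1) :
    0 ≤ roundProb q L J ∧ roundProb q L J ≤ (64 * J + L) * q := by
  induction J with
  | zero => simp only [roundProb]; exact ⟨by positivity, by simp⟩
  | succ J ih =>
    push_cast at h
    have hLq : 0 ≤ L * q := by positivity
    have hJq : 0 ≤ (64 * J : ℝ) * q := by positivity
    obtain ⟨h0, h1⟩ := ih (by nlinarith)
    simp only [roundProb]
    push_cast
    constructor
    · have : 64 * q ≤ 1 := by nlinarith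
      nlinarith
    · have := mul_nonneg hq h0
      nlinarith

lemma cost_mul_miss_le {X : Finset α} {q L : ℝ} {K : ℕ} (hq : 0 ≤ q) (hL : 1 ≤ L) (J : ℕ)
    (hJ : (64 * J + L) * q ≤ 1) (H : Finset (Finset α)) (c : ℝ)
    (hX : ∀ S ∈ H, S ⊆ X) (hℓ : ∀ S ∈ H, S.card ≤ K * 2 ^ J)
    (hc : ∀ 𝒢, IsCover 𝒢 H → c ≤ ∑ U ∈ 𝒢, q ^ U.card) :
    c * bernExp X (roundProb q L J) (missInd H) ≤
      2 ^ K / L + ∑ i ∈ Finset.range J, (1 / 16 : ℝ) ^ (K * 2 ^ i) := by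
  induction J generalizing H c with
  | zero =>
    have h1 : L * q ≤ 1 := by simpa using hJ
    have := cost_mul_miss_le_of_last (X := X) (H := H) (ℓ := K) (p := L * q) (q := q)
      (x := 1 / L) (c := c) hX (by simpa using hℓ) hq (by positivity) h1 (by positivity)
      ((div_le_one (by linarith)).2 hL) (by field_simp; rfl) hc
    simpa [roundProb, div_eq_mul_inv] using this
  | succ J ih =>
    have hb := roundProb_bounds hq (by linarith : 0 ≤ L) (J + 1) hJ
    push_cast at hJ
    have hLq : 0 ≤ L * q := by positivity
    have hJq : 0 ≤ (64 * J : ℝ) * q := by positivity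
    have hJ' : (64 * J + L) * q ≤ 1 := by nlinarith
    have h64 : 64 * q ≤ 1 := by nlinarith
    have hb' := roundProb_bounds hq (by linarith : 0 ≤ L) J hJ'
    have hb1 := hb'.2.trans hJ'
    set E : ℝ := 2 ^ K / L + ∑ i ∈ Finset.range J, (1 / 16 : ℝ) ^ (K * 2 ^ i) with hE
    have hE0 : 0 ≤ E := by positivity
    rw [Finset.sum_range_succ, ← add_assoc, ← hE]
    rcases lt_or_ge c 0 with hc0 | hc0
    · have : 0 ≤ bernExp X (roundProb q L (J + 1)) (missInd H) :=
        (bernExp_const X _ 0).symm.le.trans (bernExp_mono hb.1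
          (hb.2.trans (by push_cast; exact hJ)) fun W _ => missInd_nonneg H W)
      have : 0 ≤ E + (1 / 16 : ℝ) ^ (K * 2 ^ J) := by positivity
      nlinarith
    set ℓ' := K * 2 ^ J
    let small : Finset α → Finset (Finset α) :=
      fun W => (minFrag H W).filter fun U => ¬ ℓ' ≤ U.card
    let cost : Finset α → ℝ :=
      fun W => ∑ U ∈ (minFrag H W).filter (fun U => ℓ' ≤ U.card), q ^ U.card
    have hcost0 : ∀ W, 0 ≤ cost W := fun W => Finset.sum_nonneg fun _ _ => pow_nonneg hq _
    let f : Finset α → ℝ := fun W => bernExp X (roundProb q L J) (missInd (small W))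
    have hf1 : ∀ W, f W ≤ 1 := fun W =>
      (bernExp_mono hb'.1 hb1 fun W' _ => missInd_le_one (small W) W').trans_eq
        (bernExp_const X _ 1)
    have hf : ∀ W, (c - cost W) * f W ≤ E := by
      intro W
      refine ih hJ' (small W) (c - cost W) ?_ ?_ ?_
      · intro S hS
        obtain ⟨S', hS', rfl⟩ := exists_of_mem_minFrag (Finset.mem_filter.1 hS).1
        exact Finset.sdiff_subset.trans (hX S' hS')
      · intro S hS
        exact (not_le.1 (Finset.mem_filter.1 hS).2).le
      · intro 𝒢 h𝒢
        have hcov : IsCover (𝒢 ∪ (minFrag H W).filter (fun U => ℓ' ≤ U.card)) H := by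
          intro S hS
          obtain ⟨U, hU, hUS⟩ := isCover_minFrag H W S hS
          by_cases hl : ℓ' ≤ U.card
          · exact ⟨U, Finset.mem_union_right _ (Finset.mem_filter.2 ⟨hU, hl⟩), hUS⟩
          · obtain ⟨U', hU', hUU'⟩ := h𝒢 U (Finset.mem_filter.2 ⟨hU, hl⟩)
            exact ⟨U', Finset.mem_union_left _ hU', hUU'.trans hUS⟩
        have h1 := hc _ hcov
        have h2 : ∑ U ∈ 𝒢 ∪ (minFrag H W).filter (fun U => ℓ' ≤ U.card), q ^ U.card ≤
            ∑ U ∈ 𝒢, q ^ U.card + cost W := by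
          rw [← Finset.sum_union_inter]
          exact le_add_of_nonneg_right (Finset.sum_nonneg fun _ _ => pow_nonneg hq _)
        linarith
    have hcostE : bernExp X (64 * q) cost ≤ (1 / 16 : ℝ) ^ ℓ' := by
      refine (bernExp_cost_le (m := ℓ') (x := 1 / 64) hX hℓ hq (by positivity) h64 (by norm_num)
        (by norm_num) (by linarith)).trans_eq ?_
      rw [show K * 2 ^ (J + 1) = 2 * ℓ' by simp only [ℓ']; ring, pow_mul, ← mul_pow]
      norm_num
    calc c * bernExp X (roundProb q L (J + 1)) (missInd H)
        = c * bernExp X (64 * q) (fun W₁ => bernExp X (roundProb q L J)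
            (fun W₂ => missInd H (W₁ ∪ W₂))) := by rw [bernExp_union]; rfl
      _ ≤ c * bernExp X (64 * q) f := by
          refine mul_le_mul_of_nonneg_left ?_ hc0
          refine bernExp_mono (by positivity) h64 fun W₁ _ => bernExp_mono hb'.1 hb1 fun W₂ _ => ?_
          unfold missInd
          split_ifs with h1 h2 h2 <;> try norm_num
          obtain ⟨U, hU, hUW⟩ := h2
          obtain ⟨S, hS, rfl⟩ := exists_of_mem_minFrag (Finset.mem_filter.1 hU).1
          exact h1 ⟨S, hS, sdiff_le_iff.1 hUW⟩
      _ = bernExp X (64 * q) (fun W => c * f W) := (bernExp_const_mul _ _ _ _).symm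
      _ ≤ bernExp X (64 * q) (fun W => E + cost W) := by
          refine bernExp_mono (by positivity) h64 fun W _ => ?_
          nlinarith [hf W, hf1 W, hcost0 W]
      _ = E + bernExp X (64 * q) cost := by rw [bernExp_add, bernExp_const]
      _ ≤ E + (1 / 16 : ℝ) ^ ℓ' := by linarith

lemma sum_sixteenth_le {K : ℕ} (hK : 1 ≤ K) (J : ℕ) :
    ∑ i ∈ Finset.range J, (1 / 16 : ℝ) ^ (K * 2 ^ i) ≤ 2 * (1 / 16 : ℝ) ^ K := by
  have h : ∀ i : ℕ, (1 / 16 : ℝ) ^ (K * 2 ^ i) ≤ (1 / 16 : ℝ) ^ K * (1 / 2) ^ i := by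
    intro i
    have h1 : K + i ≤ K * 2 ^ i := by
      have : i + 1 ≤ 2 ^ i := Nat.lt_two_pow_self
      nlinarith
    calc (1 / 16 : ℝ) ^ (K * 2 ^ i) ≤ (1 / 16 : ℝ) ^ (K + i) :=
          pow_le_pow_of_le_one (by norm_num) (by norm_num) h1
      _ = (1 / 16 : ℝ) ^ K * (1 / 16) ^ i := pow_add _ _ _
      _ ≤ _ := by gcongr; norm_num
  calc _ ≤ ∑ i ∈ Finset.range J, (1 / 16 : ℝ) ^ K * (1 / 2) ^ i :=
        Finset.sum_le_sum fun i _ => h i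
    _ = (1 / 16 : ℝ) ^ K * ∑ i ∈ Finset.range J, (1 / 2 : ℝ) ^ i := by rw [Finset.mul_sum]
    _ ≤ (1 / 16 : ℝ) ^ K * 2 := by
        gcongr
        exact sum_geometric_two_le J
    _ = _ := mul_comm _ _

end Bernoulli

section Splitting

variable {α : Type*} [DecidableEq α]

lemma card_filter_subset_disjoint_le {U D₁ D₂ : Finset α} (h₁ : D₁ ⊆ U) (h₂ : D₂ ⊆ U)
    (hd : Disjoint D₁ D₂) (M : ℕ) :
    ((U.powersetCard M).filter fun A => D₁ ⊆ A ∧ Disjoint D₂ A).card ≤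
      (U.card - D₁.card - D₂.card).choose (M - D₁.card) := by
  have : (U.card - D₁.card - D₂.card).choose (M - D₁.card) =
      ((U \ (D₁ ∪ D₂)).powersetCard (M - D₁.card)).card := by
    rw [Finset.card_powersetCard, Finset.card_sdiff_of_subset (Finset.union_subset h₁ h₂),
      Finset.card_union_of_disjoint hd, Nat.sub_sub]
  rw [this]
  refine Finset.card_le_card_of_injOn (· \ D₁) ?_ ?_
  · intro A hA
    simp only [Finset.mem_coe, Finset.mem_filter, Finset.mem_powersetCard] at hA
    obtain ⟨⟨hAU, hAM⟩, hDA, hdA⟩ := hA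
    rw [Finset.mem_coe, Finset.mem_powersetCard]
    refine ⟨fun x hx => ?_, by rw [Finset.card_sdiff_of_subset hDA, hAM]⟩
    rw [Finset.mem_sdiff] at hx
    rw [Finset.mem_sdiff, Finset.mem_union, not_or]
    exact ⟨hAU hx.1, hx.2, fun h => Finset.disjoint_left.1 hdA h hx.1⟩
  · intro A hA A' hA' h
    simp only [Finset.mem_coe, Finset.mem_filter] at hA hA'
    rw [← Finset.sdiff_union_of_subset hA.2.1, ← Finset.sdiff_union_of_subset hA'.2.1]
    simp only at h
    rw [h]

lemma choose_sub_sub_le {N M : ℕ} (hMN : M ≤ N) (d : ℕ) (hd : d ≤ M) :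
    ((N - d).choose (M - d) : ℝ) ≤ ((M : ℝ) / N) ^ d * (N.choose M : ℝ) := by
  induction d with
  | zero => simp
  | succ d ih =>
    have ih := ih (by omega)
    obtain ⟨m, rfl⟩ : ∃ m, M = d + 1 + m := ⟨M - (d + 1), by omega⟩
    obtain ⟨n, rfl⟩ : ∃ n, N = d + 1 + n := ⟨N - (d + 1), by omega⟩
    rw [show d + 1 + n - d = n + 1 by omega, show d + 1 + m - d = m + 1 by omega] at ih
    rw [show d + 1 + n - (d + 1) = n by omega, show d + 1 + m - (d + 1) = m by omega]
    have e : ((n : ℝ) + 1) * (n.choose m : ℝ) = ((n + 1).choose (m + 1) : ℝ) * (m + 1) := by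
      exact_mod_cast Nat.add_one_mul_choose_eq n m
    have hmn : (m : ℝ) ≤ n := by exact_mod_cast (by omega : m ≤ n)
    have e1 : (n.choose m : ℝ) = (m + 1) / (n + 1) * ((n + 1).choose (m + 1) : ℝ) := by
      field_simp
      linarith
    have e2 : ((m : ℝ) + 1) / (n + 1) ≤ ((d + 1 + m : ℕ) : ℝ) / ((d + 1 + n : ℕ) : ℝ) := by
      rw [div_le_div_iff₀ (by positivity) (by positivity)]
      push_cast
      nlinarith [(Nat.cast_nonneg d : (0 : ℝ) ≤ d)]
    rw [e1, pow_succ, mul_comm (_ ^ d) _, mul_assoc]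
    gcongr

/-- Few `M`-subsets of `U` inherit many members of a sparse `r`-uniform family: counting
sequences of disjoint members. -/
lemma card_filter_dense_le {U : Finset α} {H : Finset (Finset α)} {M r t : ℕ} {β β' : ℝ}
    (hr : 1 ≤ r) (hM : 0 < M) (hMU : M ≤ U.card) (htM : t * r ≤ M)
    (hHU : ∀ h ∈ H, h ⊆ U) (hHr : ∀ h ∈ H, h.card = r)
    (hβ' : 0 < β') (hH : (H.card : ℝ) ≤ β * (U.card : ℝ) ^ r) :
    (((U.powersetCard M).filter fun A => β' * (M : ℝ) ^ r + t * r * (M : ℝ) ^ (r - 1) ≤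
        ((H.filter (· ⊆ A)).card : ℝ)).card : ℝ) ≤
      (β / β') ^ t * (U.card.choose M : ℝ) := by
  set N := U.card with hN
  have hN0 : (0 : ℝ) < N := by exact_mod_cast (by omega : 0 < N)
  have hM0 : (0 : ℝ) < M := by exact_mod_cast hM
  set 𝒜 := (U.powersetCard M).filter fun A => β' * (M : ℝ) ^ r + t * r * (M : ℝ) ^ (r - 1) ≤
        ((H.filter (· ⊆ A)).card : ℝ) with h𝒜
  have main : ∀ j : ℕ, ∀ D ⊆ U, D.card + j * r ≤ t * r →
      ((𝒜.filter (D ⊆ ·)).card : ℝ) ≤ ((H.card : ℝ) / (β' * (M : ℝ) ^ r)) ^ j *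
        (((M : ℝ) / N) ^ (D.card + j * r) * (N.choose M : ℝ)) := by
    intro j
    induction j with
    | zero =>
      intro D hDU hD
      have h1 : ((𝒜.filter (D ⊆ ·)).card : ℝ) ≤ ((N - D.card).choose (M - D.card) : ℝ) := by
        have h2 := card_filter_subset_disjoint_le hDU (Finset.empty_subset U)
          (Finset.disjoint_empty_right D) M
        rw [Finset.card_empty, Nat.sub_zero] at h2
        refine le_trans ?_ (Nat.cast_le.2 h2)
        refine Nat.cast_le.2 (Finset.card_le_card fun A hA => ?_)
        simp only [h𝒜, Finset.mem_filter] at hA ⊢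
        exact ⟨hA.1.1, hA.2, Finset.disjoint_empty_left A⟩
      simp only [zero_mul, add_zero, pow_zero, one_mul] at hD ⊢
      exact h1.trans (choose_sub_sub_le hMU D.card (hD.trans htM))
    | succ j ih =>
      intro D hDU hD
      rw [Nat.succ_mul] at hD
      set c : ℝ := ((H.card : ℝ) / (β' * (M : ℝ) ^ r)) ^ j *
        (((M : ℝ) / N) ^ (D.card + (j + 1) * r) * (N.choose M : ℝ)) with hc
      have hpos : 0 < β' * (M : ℝ) ^ r := by positivity
      have step : ∀ A ∈ 𝒜.filter (D ⊆ ·), β' * (M : ℝ) ^ r ≤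
          ((H.filter fun h => Disjoint h D ∧ h ⊆ A).card : ℝ) := by
        intro A hA
        simp only [h𝒜, Finset.mem_filter, Finset.mem_powersetCard] at hA
        obtain ⟨⟨⟨hAU, hAM⟩, hdense⟩, hDA⟩ := hA
        have hhit : ((H.filter fun h => ¬ Disjoint h D ∧ h ⊆ A).card : ℝ) ≤
            t * r * (M : ℝ) ^ (r - 1) := by
          have hsub : (H.filter fun h => ¬ Disjoint h D ∧ h ⊆ A) ⊆
              D.biUnion fun x => ((A.erase x).powersetCard (r - 1)).image (insert x) := by
            intro h hh
            simp only [Finset.mem_filter] at hh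
            obtain ⟨hhH, hnd, hhA⟩ := hh
            obtain ⟨x, hxh, hxD⟩ := Finset.not_disjoint_iff.1 hnd
            refine Finset.mem_biUnion.2 ⟨x, hxD, Finset.mem_image.2 ⟨h.erase x, ?_,
              Finset.insert_erase hxh⟩⟩
            rw [Finset.mem_powersetCard, Finset.card_erase_of_mem hxh, hHr h hhH]
            exact ⟨Finset.erase_subset_erase x hhA, rfl⟩
          have h1 := (Finset.card_le_card hsub).trans Finset.card_biUnion_le
          have h2 : ∀ x ∈ D, (((A.erase x).powersetCard (r - 1)).image (insert x)).card ≤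
              M ^ (r - 1) := by
            intro x hx
            refine Finset.card_image_le.trans ?_
            rw [Finset.card_powersetCard]
            refine (Nat.choose_le_pow _ _).trans (Nat.pow_le_pow_left ?_ _)
            exact (Finset.card_erase_le).trans hAM.le
          have h3 := h1.trans (Finset.sum_le_sum h2)
          rw [Finset.sum_const, smul_eq_mul] at h3
          have h4 : D.card ≤ t * r := by omega
          have h5 := h3.trans (Nat.mul_le_mul_right _ h4)
          exact_mod_cast h5
        have hsplit : (H.filter (· ⊆ A)).card =
            (H.filter fun h => Disjoint h D ∧ h ⊆ A).card +
            (H.filter fun h => ¬ Disjoint h D ∧ h ⊆ A).card := by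
          rw [← Finset.card_filter_add_card_filter_not (s := H.filter (· ⊆ A))
            (fun h => Disjoint h D), Finset.filter_filter, Finset.filter_filter]
          congr 2 <;> (ext h; simp only [Finset.mem_filter]; tauto)
        have : ((H.filter (· ⊆ A)).card : ℝ) =
            ((H.filter fun h => Disjoint h D ∧ h ⊆ A).card : ℝ) +
            ((H.filter fun h => ¬ Disjoint h D ∧ h ⊆ A).card : ℝ) := by
          exact_mod_cast hsplit
        linarith
      have hcount : (𝒜.filter (D ⊆ ·)).card * (β' * (M : ℝ) ^ r) ≤ H.card * c := by
        calc (𝒜.filter (D ⊆ ·)).card * (β' * (M : ℝ) ^ r)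
            = ∑ A ∈ 𝒜.filter (D ⊆ ·), β' * (M : ℝ) ^ r := by
              rw [Finset.sum_const, nsmul_eq_mul]
          _ ≤ ∑ A ∈ 𝒜.filter (D ⊆ ·),
              ((H.filter fun h => Disjoint h D ∧ h ⊆ A).card : ℝ) := Finset.sum_le_sum step
          _ = ∑ h ∈ H, (((𝒜.filter (D ⊆ ·)).filter
              fun A => Disjoint h D ∧ h ⊆ A).card : ℝ) := by
              exact_mod_cast Finset.sum_card_bipartiteAbove_eq_sum_card_bipartiteBelow
                (s := 𝒜.filter (D ⊆ ·)) (t := H) (fun A h => Disjoint h D ∧ h ⊆ A)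
          _ ≤ ∑ h ∈ H, c := by
              refine Finset.sum_le_sum fun h hh => ?_
              by_cases hd : Disjoint h D
              · have hcard : (h ∪ D).card = r + D.card := by
                  rw [Finset.card_union_of_disjoint hd, hHr h hh]
                have := ih (h ∪ D) (Finset.union_subset (hHU h hh) hDU) (by rw [hcard]; omega)
                rw [hcard, show r + D.card + j * r = D.card + (j + 1) * r by ring] at this
                refine le_trans (Nat.cast_le.2 (Finset.card_le_card fun A hA => ?_)) this
                simp only [Finset.mem_filter] at hA ⊢
                exact ⟨hA.1.1, Finset.union_subset hA.2.2 hA.1.2⟩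
              · have : ((𝒜.filter (D ⊆ ·)).filter fun A => Disjoint h D ∧ h ⊆ A) = ∅ :=
                  Finset.filter_false_of_mem fun A _ hA => hd hA.1
                rw [this, Finset.card_empty, Nat.cast_zero]
                positivity
          _ = H.card * c := by rw [Finset.sum_const, nsmul_eq_mul]
      calc ((𝒜.filter (D ⊆ ·)).card : ℝ) ≤ H.card * c / (β' * (M : ℝ) ^ r) :=
            (le_div_iff₀ hpos).2 hcount
        _ = _ := by rw [hc, pow_succ]; ring
  have h := main t ∅ (Finset.empty_subset U) (by simp)
  simp only [Finset.empty_subset, Finset.filter_true, Finset.card_empty, zero_add] at h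
  refine h.trans ?_
  rw [← mul_assoc, mul_comm t r, pow_mul, ← mul_pow]
  refine mul_le_mul_of_nonneg_right (pow_le_pow_left₀ (by positivity) ?_ t) (by positivity)
  calc (H.card : ℝ) / (β' * (M : ℝ) ^ r) * ((M : ℝ) / N) ^ r
      ≤ (β * (N : ℝ) ^ r) / (β' * (M : ℝ) ^ r) * ((M : ℝ) / N) ^ r := by gcongr
    _ = β / β' := by rw [div_pow]; field_simp

open Classical in
/-- The `r`-sets which together with `v` form a `B`-set inside `U`. -/
noncomputable def badLink (B : Finset α → Prop) (r : ℕ) (U : Finset α) (v : α) :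
    Finset (Finset α) :=
  ((U.erase v).powersetCard r).filter fun h => B (insert v h)

/-- For each `r ∈ 𝓡`, every vertex of `U` lies in few `B`-sets of size `r + 1` inside `U`. -/
def LowBad (B : Finset α → Prop) (𝓡 : Finset ℕ) (b : ℝ) (U : Finset α) : Prop :=
  ∀ r ∈ 𝓡, ∀ v ∈ U,
    ((badLink B r U v).card : ℝ) * (((r : ℝ) + 1) ^ 2 * (r.factorial : ℝ)) ≤ b * (U.card : ℝ) ^ r

lemma LowBad.mono {B : Finset α → Prop} {𝓡 : Finset ℕ} {b b' : ℝ} {U : Finset α}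
    (h : LowBad B 𝓡 b U) (hb : b ≤ b') : LowBad B 𝓡 b' U := fun r hr v hv =>
  (h r hr v hv).trans (mul_le_mul_of_nonneg_right hb (by positivity))

open Classical in
lemma card_filter_not_lowBad_le {B : Finset α → Prop} {𝓡 : Finset ℕ} (h𝓡 : ∀ r ∈ 𝓡, 1 ≤ r)
    {b η : ℝ} (hb0 : 0 < b) (hb2 : b ≤ 2) (hη0 : 0 < η) (hη1 : η ≤ 1) {U : Finset α}
    (hU : LowBad B 𝓡 b U) {M t : ℕ} (hM : 0 < M) (hMU : M ≤ U.card)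
    (ht : ∀ r ∈ 𝓡, (t : ℝ) * r * (((r : ℝ) + 1) ^ 2 * (r.factorial : ℝ)) ≤ η / 2 * M) :
    (((U.powersetCard M).filter fun A => ¬ LowBad B 𝓡 (b + η) A).card : ℝ) ≤
      𝓡.card * U.card * ((1 / (1 + η / 4)) ^ t * (U.card.choose M : ℝ)) := by
  have hM0 : (0 : ℝ) < M := by exact_mod_cast hM
  let D : ℕ → ℝ := fun r => ((r : ℝ) + 1) ^ 2 * (r.factorial : ℝ)
  have hD : ∀ r, 1 ≤ D r := by
    intro r
    have h1 : (1 : ℝ) ≤ r.factorial := by exact_mod_cast r.factorial_pos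
    have h2 : (1 : ℝ) ≤ ((r : ℝ) + 1) ^ 2 := one_le_pow₀ (by
      linarith [(Nat.cast_nonneg r : (0 : ℝ) ≤ r)])
    exact one_le_mul_of_one_le_of_one_le h2 h1
  let bad : ℕ → α → Finset (Finset α) := fun r v => (U.powersetCard M).filter fun A =>
    ((b + η / 2) / D r) * (M : ℝ) ^ r + t * r * (M : ℝ) ^ (r - 1) ≤
        (((badLink B r U v).filter (· ⊆ A)).card : ℝ)
  have hsub : ((U.powersetCard M).filter fun A => ¬ LowBad B 𝓡 (b + η) A) ⊆
      𝓡.biUnion fun r => U.biUnion fun v => bad r v := by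
    intro A hA
    simp only [Finset.mem_filter, Finset.mem_powersetCard] at hA
    obtain ⟨⟨hAU, hAM⟩, hA⟩ := hA
    unfold LowBad at hA
    push Not at hA
    obtain ⟨r, hr, v, hv, hlt⟩ := hA
    rw [hAM] at hlt
    refine Finset.mem_biUnion.2 ⟨r, hr, Finset.mem_biUnion.2 ⟨v, hAU hv, ?_⟩⟩
    simp only [bad, Finset.mem_filter, Finset.mem_powersetCard]
    refine ⟨⟨hAU, hAM⟩, ?_⟩
    have hle : ((badLink B r A v).card : ℝ) ≤ (((badLink B r U v).filter (· ⊆ A)).card : ℝ) := by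
      refine Nat.cast_le.2 (Finset.card_le_card fun h hh => ?_)
      simp only [badLink, Finset.mem_filter, Finset.mem_powersetCard] at hh ⊢
      exact ⟨⟨⟨hh.1.1.trans (Finset.erase_subset_erase v hAU), hh.1.2⟩, hh.2⟩,
        hh.1.1.trans (Finset.erase_subset v A)⟩
    refine le_trans ?_ hle
    have hDr : 0 < D r := by linarith [hD r]
    have e : (M : ℝ) ^ r = M ^ (r - 1) * M := by
      rw [← pow_succ, Nat.sub_add_cancel (h𝓡 r hr)]
    have h1 : (t * r * (M : ℝ) ^ (r - 1)) * D r ≤ η / 2 * M ^ r := by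
      calc (t * r * (M : ℝ) ^ (r - 1)) * D r = (t * r * D r) * (M : ℝ) ^ (r - 1) := by ring
        _ ≤ (η / 2 * M) * (M : ℝ) ^ (r - 1) :=
          mul_le_mul_of_nonneg_right (ht r hr) (by positivity)
        _ = η / 2 * M ^ r := by rw [e]; ring
    have h2 : ((b + η / 2) / D r * (M : ℝ) ^ r + t * r * (M : ℝ) ^ (r - 1)) * D r ≤
        ((badLink B r A v).card : ℝ) * D r := by
      have : (b + η / 2) / D r * (M : ℝ) ^ r * D r = (b + η / 2) * M ^ r := by field_simp
      rw [add_mul, this]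
      have : ((badLink B r A v).card : ℝ) * D r > (b + η) * M ^ r := hlt
      linarith
    exact le_of_mul_le_mul_right h2 hDr
  have hbad : ∀ r ∈ 𝓡, ∀ v ∈ U, ((bad r v).card : ℝ) ≤
      (1 / (1 + η / 4)) ^ t * (U.card.choose M : ℝ) := by
    intro r hr v hv
    have hDr : 0 < D r := by linarith [hD r]
    have htM : t * r ≤ M := by
      have h1 := ht r hr
      have h2 : (t : ℝ) * r ≤ t * r * D r := le_mul_of_one_le_right (by positivity) (hD r)
      have h3 : (t : ℝ) * r ≤ M := by
        have : η / 2 * M ≤ 1 * M := by gcongr; linarith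
        linarith [h2.trans h1]
      exact_mod_cast h3
    have := card_filter_dense_le (U := U) (H := badLink B r U v) (M := M) (r := r) (t := t)
      (β := b / D r) (β' := (b + η / 2) / D r) (h𝓡 r hr) hM hMU htM
      (fun h hh => (Finset.mem_powersetCard.1 (Finset.mem_filter.1 hh).1).1.trans
        (Finset.erase_subset v U))
      (fun h hh => (Finset.mem_powersetCard.1 (Finset.mem_filter.1 hh).1).2) (by positivity)
      (by rw [div_mul_eq_mul_div]; exact (le_div_iff₀ hDr).2 (hU r hr v hv))
    refine this.trans (mul_le_mul_of_nonneg_right (pow_le_pow_left₀ (by positivity) ?_ t)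
      (by positivity))
    rw [div_div_div_cancel_right₀ hDr.ne', div_le_div_iff₀ (by positivity) (by positivity)]
    nlinarith
  calc (((U.powersetCard M).filter fun A => ¬ LowBad B 𝓡 (b + η) A).card : ℝ)
      ≤ ((𝓡.biUnion fun r => U.biUnion fun v => bad r v).card : ℝ) :=
        Nat.cast_le.2 (Finset.card_le_card hsub)
    _ ≤ ∑ r ∈ 𝓡, ∑ v ∈ U, ((bad r v).card : ℝ) := by
        have : (𝓡.biUnion fun r => U.biUnion fun v => bad r v).card ≤
            ∑ r ∈ 𝓡, ∑ v ∈ U, (bad r v).card :=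
          Finset.card_biUnion_le.trans (Finset.sum_le_sum fun r _ => Finset.card_biUnion_le)
        exact_mod_cast this
    _ ≤ ∑ r ∈ 𝓡, ∑ v ∈ U, (1 / (1 + η / 4)) ^ t * (U.card.choose M : ℝ) :=
        Finset.sum_le_sum fun r hr => Finset.sum_le_sum fun v hv => hbad r hr v hv
    _ = _ := by simp only [Finset.sum_const, nsmul_eq_mul]; ring

lemma inv_one_add_pow_le {η : ℝ} (hη : 0 < η) {t : ℕ} (ht : 0 < t) :
    (1 / (1 + η / 4)) ^ (4 * t) ≤ (4 / (t * η)) ^ 4 := by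
  have ht0 : (0 : ℝ) < t := by exact_mod_cast ht
  rw [mul_comm, pow_mul]
  refine pow_le_pow_left₀ (by positivity) ?_ 4
  rw [div_pow, one_pow, div_le_div_iff₀ (by positivity) (by positivity)]
  have := one_add_mul_le_pow (a := η / 4) (by linarith) t
  linarith

open Classical in
/-- A random split of `U` into two large parts keeps all bad degrees low in both parts. -/
lemma exists_split_const (𝓡 : Finset ℕ) (h𝓡 : ∀ r ∈ 𝓡, 1 ≤ r) :
    ∃ y : ℝ, 0 < y ∧ ∀ {α : Type} [DecidableEq α] (B : Finset α → Prop) (U : Finset α)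
      (b η M : ℝ) (M₁ M₂ : ℕ), 0 < b → b ≤ 2 → 0 < η → η ≤ 1 → LowBad B 𝓡 b U → M₁ + M₂ = U.card →
      0 < M → M ≤ M₁ → M ≤ M₂ → 1 ≤ y * η * M →
      (((U.powersetCard M₁).filter fun A =>
          ¬ (LowBad B 𝓡 (b + η) A ∧ LowBad B 𝓡 (b + η) (U \ A))).card : ℝ) ≤
        2 * 𝓡.card * U.card * (1 / (y * η ^ 2 * M)) ^ 4 * (U.card.choose M₁ : ℝ) := by
  let S : ℝ := ∑ r ∈ 𝓡, (r : ℝ) * (((r : ℝ) + 1) ^ 2 * (r.factorial : ℝ))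
  have hS : 0 ≤ S := Finset.sum_nonneg fun r _ => by positivity
  let c₀ : ℝ := 1 / (8 * (S + 1))
  have hc₀ : 0 < c₀ := by positivity
  refine ⟨c₀ / 8, by positivity, ?_⟩
  intro α _ B U b η M M₁ M₂ hb0 hb2 hη0 hη1 hU hsum hM0 hM₁ hM₂ hy
  have side : ∀ m : ℕ, M ≤ m → m ≤ U.card →
      (((U.powersetCard m).filter fun A => ¬ LowBad B 𝓡 (b + η) A).card : ℝ) ≤
        𝓡.card * U.card * (1 / (c₀ / 8 * η ^ 2 * M)) ^ 4 * (U.card.choose m : ℝ) := by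
    intro m hMm hmU
    have hm0 : (0 : ℝ) < m := hM0.trans_le hMm
    have hxM : c₀ * η * M ≤ c₀ * η * m := by gcongr
    have hx8 : 8 ≤ c₀ * η * m := by
      have : c₀ / 8 * η * M = c₀ * η * M / 8 := by ring
      rw [this] at hy
      linarith
    set x := c₀ * η * m with hx
    have ht_le : (⌊x⌋₊ : ℝ) ≤ x := Nat.floor_le (by linarith)
    have ht_ge : x / 2 ≤ ⌊x⌋₊ := by linarith [Nat.lt_floor_add_one x]
    have ht_pos : 0 < ⌊x⌋₊ := Nat.floor_pos.2 (by linarith)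
    have h1 := card_filter_not_lowBad_le h𝓡 hb0 hb2 hη0 hη1 hU (M := m) (t := 4 * ⌊x⌋₊)
      (by exact_mod_cast hm0) hmU (by
        intro r hr
        have hrS : (r : ℝ) * (((r : ℝ) + 1) ^ 2 * (r.factorial : ℝ)) ≤ S :=
          Finset.single_le_sum (f := fun r : ℕ => (r : ℝ) * (((r : ℝ) + 1) ^ 2 *
            (r.factorial : ℝ))) (fun r _ => by positivity) hr
        push_cast
        calc 4 * (⌊x⌋₊ : ℝ) * r * (((r : ℝ) + 1) ^ 2 * (r.factorial : ℝ))
            = 4 * (⌊x⌋₊ : ℝ) * (r * (((r : ℝ) + 1) ^ 2 * (r.factorial : ℝ))) := by ring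
          _ ≤ 4 * x * (S + 1) := by gcongr; linarith
          _ = η / 2 * m := by simp only [hx, c₀]; field_simp; norm_num)
    refine h1.trans ?_
    rw [← mul_assoc]
    refine mul_le_mul_of_nonneg_right (mul_le_mul_of_nonneg_left ?_ (by positivity))
      (by positivity)
    refine (inv_one_add_pow_le hη0 ht_pos).trans (pow_le_pow_left₀ (by positivity) ?_ 4)
    rw [div_le_div_iff₀ (by positivity) (by positivity)]
    have : x / 2 * η ≤ (⌊x⌋₊ : ℝ) * η := by gcongr
    have h2 : c₀ * η * M * η ≤ x * η := by gcongr
    nlinarith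
  have hs1 := side M₁ hM₁ (by omega)
  have hs2 := side M₂ hM₂ (by omega)
  have hch : U.card.choose M₂ = U.card.choose M₁ := by
    rw [← hsum, Nat.choose_symm_add]
  rw [hch] at hs2
  have hcompl : ((U.powersetCard M₁).filter fun A => ¬ LowBad B 𝓡 (b + η) (U \ A)).card ≤
      ((U.powersetCard M₂).filter fun A => ¬ LowBad B 𝓡 (b + η) A).card := by
    refine Finset.card_le_card_of_injOn (U \ ·) ?_ ?_
    · intro A hA
      simp only [Finset.mem_coe, Finset.mem_filter, Finset.mem_powersetCard] at hA ⊢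
      refine ⟨⟨Finset.sdiff_subset, ?_⟩, hA.2⟩
      rw [Finset.card_sdiff_of_subset hA.1.1]
      omega
    · intro A hA A' hA' h
      simp only [Finset.mem_coe, Finset.mem_filter, Finset.mem_powersetCard] at hA hA' h
      rw [← Finset.sdiff_sdiff_eq_self hA.1.1, ← Finset.sdiff_sdiff_eq_self hA'.1.1, h]
  have hun : ((U.powersetCard M₁).filter fun A =>
      ¬ (LowBad B 𝓡 (b + η) A ∧ LowBad B 𝓡 (b + η) (U \ A))).card ≤
      ((U.powersetCard M₁).filter fun A => ¬ LowBad B 𝓡 (b + η) A).card +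
      ((U.powersetCard M₁).filter fun A => ¬ LowBad B 𝓡 (b + η) (U \ A)).card := by
    simp only [not_and_or, Finset.filter_or]
    exact Finset.card_union_le _ _
  have hun' : (((U.powersetCard M₁).filter fun A =>
      ¬ (LowBad B 𝓡 (b + η) A ∧ LowBad B 𝓡 (b + η) (U \ A))).card : ℝ) ≤
      (((U.powersetCard M₁).filter fun A => ¬ LowBad B 𝓡 (b + η) A).card : ℝ) +
      (((U.powersetCard M₂).filter fun A => ¬ LowBad B 𝓡 (b + η) A).card : ℝ) := by
    exact_mod_cast hun.trans (by omega)
  linarith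

end Splitting

section Exchange

variable {α : Type*} [DecidableEq α]

/-- The `i`-th block of a set enumerated by `Fin q × Fin s`. -/
def block {q s : ℕ} {A : Finset α} (e : Fin q × Fin s ≃ A) (i : Fin q) : Finset α :=
  Finset.univ.image fun x => (e (i, x) : α)

open Classical in
/-- A `B`-block can be mixed with `r` other blocks so that all transversals are not `B`. -/
lemma exists_transversals {B : Finset α → Prop} {r q : ℕ} (hr : 9 ≤ r) (hq : 2 * r ^ 2 ≤ q)
    {A : Finset α} (e : Fin q × Fin (r + 1) ≃ A)
    (hB : ∀ v ∈ A, ((badLink B r A v).card : ℝ) * (((r : ℝ) + 1) ^ 2 * (r.factorial : ℝ)) ≤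
      3 * (A.card : ℝ) ^ r) (i₀ : Fin q) :
    ∃ (b : Fin r ↪ {i : Fin q // i ≠ i₀}) (c : Fin r → Fin (r + 1)), ∀ y : Fin (r + 1),
      ¬ B (insert (e (i₀, y) : α)
        (Finset.univ.image fun j => (e ((b j : Fin q), y + c j) : α))) := by
  by_contra! hcon
  let T := (Fin r ↪ {i : Fin q // i ≠ i₀}) × (Fin r → Fin (r + 1))
  let row : Fin (r + 1) → T → Finset α := fun y t =>
    Finset.univ.image fun j => (e ((t.1 j : Fin q), y + t.2 j) : α)
  have hinj : ∀ (y : Fin (r + 1)) (t : T),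
      Function.Injective fun j => (e ((t.1 j : Fin q), y + t.2 j) : α) := by
    intro y t j j' h
    have h1 := e.injective (Subtype.ext h)
    exact t.1.injective (Subtype.ext (Prod.ext_iff.1 h1).1)
  have hAcard : A.card = q * (r + 1) := by
    have := Fintype.card_congr e
    simpa using this.symm
  have hrow : ∀ y : Fin (r + 1),
      (Finset.univ.filter fun t : T => B (insert (e (i₀, y) : α) (row y t))).card ≤
        r.factorial * (badLink B r A (e (i₀, y))).card := by
    intro y
    refine Finset.card_le_mul_card_image_of_maps_to (f := row y) ?_ _ ?_
    · intro t ht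
      simp only [badLink, Finset.mem_filter, Finset.mem_powersetCard]
      refine ⟨⟨?_, ?_⟩, (Finset.mem_filter.1 ht).2⟩
      · intro x hx
        obtain ⟨j, _, rfl⟩ := Finset.mem_image.1 hx
        refine Finset.mem_erase.2 ⟨fun h => ?_, (e _).2⟩
        have h1 := e.injective (Subtype.ext h)
        exact (t.1 j).2 (Prod.ext_iff.1 h1).1
      · rw [Finset.card_image_of_injective _ (hinj y t), Finset.card_univ, Fintype.card_fin]
    · intro h hh
      have hhr : h.card = r := by
        simp only [badLink, Finset.mem_filter, Finset.mem_powersetCard] at hh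
        exact hh.1.2
      have hemb : Fintype.card (Fin r ↪ h) = r.factorial := by
        rw [Fintype.card_embedding_eq, Fintype.card_coe, Fintype.card_fin, hhr,
          Nat.descFactorial_self]
      rw [← hemb, ← Fintype.card_coe]
      refine Fintype.card_le_of_injective (fun t => ⟨fun j =>
        ⟨(e ((t.1.1 j : Fin q), y + t.1.2 j) : α), ?_⟩, ?_⟩) ?_
      · exact (Finset.mem_filter.1 t.2).2.subset (Finset.mem_image_of_mem _ (Finset.mem_univ j))
      · intro j j' hjj
        exact hinj y t.1 (congrArg (fun z : h => (z : α)) hjj)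
      · intro t t' htt
        have key : ∀ j, (t.1.1 j : Fin q) = t'.1.1 j ∧ t.1.2 j = t'.1.2 j := by
          intro j
          have h1 := Subtype.ext_iff.1 (DFunLike.congr_fun htt j)
          have h2 := e.injective (Subtype.ext h1)
          exact ⟨(Prod.ext_iff.1 h2).1, add_left_cancel (Prod.ext_iff.1 h2).2⟩
        refine Subtype.ext (Prod.ext ?_ ?_)
        · exact DFunLike.ext _ _ fun j => Subtype.ext (key j).1
        · exact funext fun j => (key j).2
  have hT : Fintype.card T = (q - 1).descFactorial r * (r + 1) ^ r := by
    simp only [T, Fintype.card_prod, Fintype.card_embedding_eq, Fintype.card_fun,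
      Fintype.card_fin]
    congr 2
    rw [Fintype.card_subtype_compl, Fintype.card_fin, Fintype.card_unique]
  have hcover : (Finset.univ : Finset T) ⊆ Finset.univ.biUnion fun y : Fin (r + 1) =>
      Finset.univ.filter fun t : T => B (insert (e (i₀, y) : α) (row y t)) := by
    intro t _
    obtain ⟨y, hy⟩ := hcon t.1 t.2
    exact Finset.mem_biUnion.2 ⟨y, Finset.mem_univ y, Finset.mem_filter.2 ⟨Finset.mem_univ t, hy⟩⟩
  have hle : (q - 1).descFactorial r * (r + 1) ^ r ≤
      ∑ y : Fin (r + 1), r.factorial * (badLink B r A (e (i₀, y))).card := by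
    rw [← hT, ← Finset.card_univ]
    exact (Finset.card_le_card hcover).trans
      (Finset.card_biUnion_le.trans (Finset.sum_le_sum fun y _ => hrow y))
  have hle' : ((q - 1).descFactorial r : ℝ) * ((r : ℝ) + 1) ^ r ≤
      ∑ y : Fin (r + 1), (r.factorial : ℝ) * (badLink B r A (e (i₀, y))).card := by
    exact_mod_cast hle
  have hr9 : (9 : ℝ) ≤ r := by exact_mod_cast hr
  have hf0 : (0 : ℝ) < r.factorial := by exact_mod_cast r.factorial_pos
  have hsum : (∑ y : Fin (r + 1), (r.factorial : ℝ) * (badLink B r A (e (i₀, y))).card) *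
      (r + 1) ≤ 3 * (q : ℝ) ^ r * ((r : ℝ) + 1) ^ r := by
    rw [Finset.sum_mul]
    have hterm : ∀ y : Fin (r + 1),
        (r.factorial : ℝ) * (badLink B r A (e (i₀, y))).card * (r + 1) ≤
          3 * (q : ℝ) ^ r * ((r : ℝ) + 1) ^ r / (r + 1) := by
      intro y
      have := hB _ (e (i₀, y)).2
      rw [hAcard] at this
      push_cast at this
      rw [mul_pow] at this
      rw [le_div_iff₀ (by positivity)]
      calc _ = ((badLink B r A (e (i₀, y))).card : ℝ) *
            (((r : ℝ) + 1) ^ 2 * (r.factorial : ℝ)) := by ring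
        _ ≤ _ := this
        _ = _ := by ring
    refine (Finset.sum_le_sum fun y _ => hterm y).trans_eq ?_
    rw [Finset.sum_const, Finset.card_univ, Fintype.card_fin, nsmul_eq_mul]
    push_cast
    field_simp
  have hrq : r ≤ q := by nlinarith
  have hq0 : (0 : ℝ) < q := by exact_mod_cast (by omega : 0 < q)
  have hdesc : (q : ℝ) ^ r / 2 ≤ ((q - 1).descFactorial r : ℝ) := by
    have h1 : (q - r) ^ r ≤ (q - 1).descFactorial r := by
      have := Nat.pow_sub_le_descFactorial (q - 1) r
      rwa [Nat.sub_add_cancel (by omega)] at this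
    have h2 : ((q : ℝ) - r) ^ r ≤ ((q - 1).descFactorial r : ℝ) := by
      rw [← Nat.cast_sub hrq]
      exact_mod_cast h1
    have h3 : (2 : ℝ) * r ^ 2 ≤ q := by exact_mod_cast hq
    have hrq' : (r : ℝ) ≤ q := by exact_mod_cast hrq
    have h4 := one_add_mul_le_pow (a := -((r : ℝ) / q)) (by
      have : (r : ℝ) / q ≤ 1 := (div_le_one hq0).2 hrq'
      linarith) r
    have h5 : (r : ℝ) * (r / q) ≤ 1 / 2 := by
      rw [← mul_div_assoc, div_le_iff₀ hq0]
      nlinarith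
    calc (q : ℝ) ^ r / 2 = q ^ r * (1 / 2) := by ring
      _ ≤ q ^ r * (1 + -((r : ℝ) / q)) ^ r := by
        gcongr
        linarith
      _ = ((q : ℝ) - r) ^ r := by
        rw [← mul_pow]
        congr 1
        field_simp
        ring
      _ ≤ _ := h2
  have hpos : 0 < ((r : ℝ) + 1) ^ r := by positivity
  have hqr : 0 < (q : ℝ) ^ r := by positivity
  have h6 : ((q - 1).descFactorial r : ℝ) * (r + 1) ≤ 3 * (q : ℝ) ^ r := by
    refine le_of_mul_le_mul_right ?_ hpos
    calc ((q - 1).descFactorial r : ℝ) * (r + 1) * ((r : ℝ) + 1) ^ r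
        = ((q - 1).descFactorial r : ℝ) * ((r : ℝ) + 1) ^ r * (r + 1) := by ring
      _ ≤ _ := (mul_le_mul_of_nonneg_right hle' (by positivity)).trans hsum
  nlinarith

/-- A set with low `B`-degrees can be partitioned into blocks which are not `B`. -/
lemma exists_good_blocks {B : Finset α → Prop} {r q : ℕ} (hr : 9 ≤ r) (hq : 2 * r ^ 2 ≤ q)
    {A : Finset α} (hA : A.card = q * (r + 1))
    (hB : ∀ v ∈ A, ((badLink B r A v).card : ℝ) * (((r : ℝ) + 1) ^ 2 * (r.factorial : ℝ)) ≤
      3 * (A.card : ℝ) ^ r) :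
    ∃ e : Fin q × Fin (r + 1) ≃ A, ∀ i, ¬ B (block e i) := by
  classical
  have hne : Nonempty (Fin q × Fin (r + 1) ≃ A) :=
    ⟨Fintype.equivOfCardEq (by simp [hA])⟩
  obtain ⟨e, he⟩ := Finite.exists_min fun e : Fin q × Fin (r + 1) ≃ A =>
    (Finset.univ.filter fun i => B (block e i)).card
  refine ⟨e, fun i₀ hi₀ => ?_⟩
  obtain ⟨b, c, hbc⟩ := exists_transversals hr hq e hB i₀
  let β : Fin (r + 1) ↪ Fin q := ⟨Fin.cons i₀ fun j => (b j : Fin q), by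
    rw [Fin.cons_injective_iff]
    refine ⟨?_, Subtype.val_injective.comp b.injective⟩
    rintro ⟨j, hj⟩
    exact (b j).2 hj⟩
  let c' : Fin (r + 1) → Fin (r + 1) := Fin.cons 0 c
  let σ : Equiv.Perm (Fin (r + 1) × Fin (r + 1)) :=
    { toFun := fun z => (z.2, z.1 + c' z.2)
      invFun := fun z => (z.2 - c' z.1, z.1)
      left_inv := fun z => by simp
      right_inv := fun z => by simp }
  let ι : Fin (r + 1) × Fin (r + 1) ↪ Fin q × Fin (r + 1) :=
    β.prodMap (Function.Embedding.refl _)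
  let e' := (σ.viaEmbedding ι).trans e
  have h1 : ∀ y, ¬ B (block e' (β y)) := by
    intro y
    have : block e' (β y) =
        insert (e (i₀, y) : α) (Finset.univ.image fun j => (e ((b j : Fin q), y + c j) : α)) := by
      have hx : ∀ x, e' (β y, x) = e (β x, y + c' x) := fun x =>
        congrArg e (σ.viaEmbedding_apply ι (y, x))
      unfold block
      simp only [hx]
      rw [Fin.univ_succ, Finset.cons_eq_insert, Finset.image_insert, Finset.map_eq_image,
        Finset.image_image]
      congr 1
      simp [β, c']
    rw [this]
    exact hbc y
  have h2 : ∀ i, i ∉ Set.range β → block e' i = block e i := by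
    intro i hi
    have hx : ∀ x, e' (i, x) = e (i, x) := fun x =>
      congrArg e (σ.viaEmbedding_apply_of_notMem ι (i, x) (by
        rintro ⟨z, hz⟩
        exact hi ⟨z.1, (Prod.ext_iff.1 hz).1⟩))
    unfold block
    simp only [hx]
  refine absurd (he e') (not_le.2 (Finset.card_lt_card ?_))
  rw [Finset.ssubset_iff_of_subset]
  · exact ⟨i₀, by simpa using hi₀, fun h => h1 0 (Finset.mem_filter.1 h).2⟩
  · intro i hi
    simp only [Finset.mem_filter, Finset.mem_univ, true_and] at hi ⊢
    by_cases hr : i ∈ Set.range β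
    · obtain ⟨y, rfl⟩ := hr
      exact absurd hi (h1 y)
    · rwa [h2 i hr] at hi

end Exchange

section Tiling

variable {n : ℕ}

lemma hasPM_empty (G : Finset (Finset (Fin n))) : HasPM ∅ G :=
  ⟨∅, by simp, by simp, by simp, by simp⟩

lemma HasPM.union {S T : Finset (Fin n)} {G : Finset (Finset (Fin n))} (hS : HasPM S G)
    (hT : HasPM T G) (hd : Disjoint S T) : HasPM (S ∪ T) G := by
  obtain ⟨M, hMG, hMS, hMd, hMc⟩ := hS
  obtain ⟨M', hMG', hMS', hMd', hMc'⟩ := hT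
  refine ⟨M ∪ M', Finset.union_subset hMG hMG', ?_, ?_, ?_⟩
  · intro e he
    rcases Finset.mem_union.1 he with h | h
    · exact (hMS e h).trans Finset.subset_union_left
    · exact (hMS' e h).trans Finset.subset_union_right
  · intro e he f hf hef
    rcases Finset.mem_union.1 he with h | h <;> rcases Finset.mem_union.1 hf with h' | h'
    · exact hMd e h f h' hef
    · exact hd.mono (hMS e h) (hMS' f h')
    · exact (hd.mono (hMS f h') (hMS' e h)).symm
    · exact hMd' e h f h' hef
  · intro v hv
    rcases Finset.mem_union.1 hv with h | h
    · obtain ⟨e, he, hve⟩ := hMc v h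
      exact ⟨e, Finset.mem_union_left _ he, hve⟩
    · obtain ⟨e, he, hve⟩ := hMc' v h
      exact ⟨e, Finset.mem_union_right _ he, hve⟩

lemma HasPM.biUnion {ι : Type*} [DecidableEq ι] {G : Finset (Finset (Fin n))} (I : Finset ι)
    (f : ι → Finset (Fin n)) (hf : ∀ i ∈ I, HasPM (f i) G)
    (hd : ∀ i j, i ≠ j → Disjoint (f i) (f j)) : HasPM (I.biUnion f) G := by
  induction I using Finset.induction_on with
  | empty => exact hasPM_empty G
  | insert i I hi ih =>
    rw [Finset.biUnion_insert]
    refine (hf i (Finset.mem_insert_self i I)).union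
      (ih fun j hj => hf j (Finset.mem_insert_of_mem hj)) ?_
    rw [Finset.disjoint_biUnion_right]
    exact fun j hj => hd i j fun h => hi (h ▸ hj)

lemma hasPM_of_lowBad {G : Finset (Finset (Fin n))} {r q : ℕ} (hr : 9 ≤ r) (hq : 2 * r ^ 2 ≤ q)
    {A : Finset (Fin n)} (hA : A.card = q * (r + 1)) {𝓡 : Finset ℕ} (h𝓡 : r ∈ 𝓡)
    (hB : LowBad (fun S => ¬ HasPM S G) 𝓡 3 A) : HasPM A G := by
  obtain ⟨e, he⟩ := exists_good_blocks hr hq hA (hB r h𝓡)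
  simp only [not_not] at he
  have hAe : A = Finset.univ.biUnion (block e) := by
    ext v
    simp only [block, Finset.mem_biUnion, Finset.mem_image, Finset.mem_univ, true_and]
    constructor
    · intro hv
      exact ⟨(e.symm ⟨v, hv⟩).1, (e.symm ⟨v, hv⟩).2, by simp⟩
    · rintro ⟨i, x, rfl⟩
      exact (e (i, x)).2
  rw [hAe]
  refine HasPM.biUnion _ _ (fun i _ => he i) fun i j hij => ?_
  rw [Finset.disjoint_left]
  intro v hv hv'
  obtain ⟨x, _, rfl⟩ := Finset.mem_image.1 hv
  obtain ⟨x', _, h⟩ := Finset.mem_image.1 hv'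
  exact hij (Prod.ext_iff.1 (e.injective (Subtype.ext h))).1.symm

lemma exists_balanced_combination {a m : ℕ} (ha : 1 ≤ a) (hm : 6 * (a * (a + 1)) ≤ m) :
    ∃ x y : ℕ, m = a * x + (a + 1) * y ∧ m ≤ 3 * (a * x) ∧ m ≤ 3 * ((a + 1) * y) := by
  set d := a * (a + 1) with hd
  have hd0 : 0 < d := by positivity
  obtain ⟨z, w, hzw, hw⟩ : ∃ z w, m = 2 * d * z + w ∧ w < 2 * d :=
    ⟨m / (2 * d), m % (2 * d), (Nat.div_add_mod m (2 * d)).symm, Nat.mod_lt _ (by positivity)⟩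
  obtain ⟨u, v, huv, hv⟩ : ∃ u v, m = a * u + v ∧ v < a :=
    ⟨m / a, m % a, (Nat.div_add_mod m a).symm, Nat.mod_lt _ ha⟩
  have hav : (a + 1) * v ≤ d := by rw [hd, mul_comm a]; gcongr
  have hle : v + (a + 1) * z ≤ u := by
    by_contra! hlt
    have h1 : a * u + a ≤ a * (v + (a + 1) * z) := by nlinarith
    have h2 : a * (v + (a + 1) * z) = a * v + d * z := by rw [hd]; ring
    nlinarith
  obtain ⟨x, rfl⟩ := Nat.exists_eq_add_of_le hle
  refine ⟨x, v + a * z, ?_, ?_, ?_⟩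
  · rw [huv]; ring
  · have : m = a * x + (a + 1) * v + d * z := by rw [huv, hd]; ring
    nlinarith
  · have : (a + 1) * (v + a * z) = (a + 1) * v + d * z := by rw [hd]; ring
    nlinarith

/-- Large sets in which almost all small sets through each vertex have perfect matchings have a
perfect matching. -/
lemma exists_hasPM_const {k a : ℕ} (hk : 2 ≤ k) (ha : 5 ≤ a) :
    ∃ R₀ : ℕ, ∀ (n m : ℕ) (G : Finset (Finset (Fin n))) (W : Finset (Fin n)), R₀ ≤ m →
      W.card = k * m → LowBad (fun S => ¬ HasPM S G) {k * a - 1, k * (a + 1) - 1} 2 W →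
      HasPM W G := by
  classical
  set 𝓡 : Finset ℕ := {k * a - 1, k * (a + 1) - 1} with h𝓡
  have hka : 10 ≤ k * a := by nlinarith
  have hka' : k * a ≤ k * (a + 1) := by gcongr; omega
  obtain ⟨r₁, hr₁⟩ : ∃ r, k * a = r + 1 := ⟨k * a - 1, by omega⟩
  obtain ⟨r₂, hr₂⟩ : ∃ r, k * (a + 1) = r + 1 := ⟨k * (a + 1) - 1, by omega⟩
  have hm₁ : r₁ ∈ 𝓡 := by simp [h𝓡, hr₁]
  have hm₂ : r₂ ∈ 𝓡 := by simp [h𝓡, hr₂]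
  obtain ⟨y, hy, hsplit⟩ := exists_split_const 𝓡 (by
    intro r hr
    simp only [h𝓡, Finset.mem_insert, Finset.mem_singleton] at hr
    omega)
  obtain ⟨R₁, hR₁⟩ := exists_nat_ge (3 / y + 324 / y ^ 4)
  refine ⟨R₁ + 6 * (a * (a + 1)) + 6 * (a * r₁ ^ 2) + 6 * ((a + 1) * r₂ ^ 2) + 1, ?_⟩
  intro n m G W hm hW hlow
  obtain ⟨x, z, hxz, hx, hz⟩ := exists_balanced_combination (a := a) (m := m) (by omega) (by omega)
  have hx2 : 2 * r₁ ^ 2 ≤ x := by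
    by_contra! h
    have : a * x < a * (2 * r₁ ^ 2) := Nat.mul_lt_mul_of_pos_left h (by omega)
    nlinarith
  have hz2 : 2 * r₂ ^ 2 ≤ z := by
    by_contra! h
    have : (a + 1) * z < (a + 1) * (2 * r₂ ^ 2) := Nat.mul_lt_mul_of_pos_left h (by omega)
    nlinarith
  have hN1 : 1 ≤ k * m := Nat.mul_pos (by omega) (by omega)
  have hmN : (m : ℝ) ≤ (k * m : ℕ) := by exact_mod_cast Nat.le_mul_of_pos_left m (by omega)
  have hNR : 3 / y + 324 / y ^ 4 < (k * m : ℕ) := by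
    have : (R₁ : ℝ) + 1 ≤ m := by exact_mod_cast (by omega : R₁ + 1 ≤ m)
    linarith
  have hsum : k * (a * x) + k * ((a + 1) * z) = W.card := by rw [hW, hxz]; ring
  have h3x : k * m ≤ 3 * (k * (a * x)) := by
    calc k * m ≤ k * (3 * (a * x)) := by gcongr
      _ = _ := by ring
  have h3z : k * m ≤ 3 * (k * ((a + 1) * z)) := by
    calc k * m ≤ k * (3 * ((a + 1) * z)) := by gcongr
      _ = _ := by ring
  have h3x' : ((k * m : ℕ) : ℝ) ≤ 3 * (k * (a * x) : ℕ) := by exact_mod_cast h3x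
  have h3z' : ((k * m : ℕ) : ℝ) ≤ 3 * (k * ((a + 1) * z) : ℕ) := by exact_mod_cast h3z
  have hN1' : (1 : ℝ) ≤ ((k * m : ℕ) : ℝ) := by exact_mod_cast hN1
  set N : ℝ := ((k * m : ℕ) : ℝ) with hN
  have h3y : 0 < 3 / y := by positivity
  have h324 : 0 < 324 / y ^ 4 := by positivity
  have hyN : 3 < y * N := by
    have : 3 / y < N := by linarith
    rwa [div_lt_iff₀ hy, mul_comm] at this
  have hyN' : 324 < N * y ^ 4 := (div_lt_iff₀ (by positivity)).1 (by linarith)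
  have hb := hsplit _ W 2 1 (N / 3) (k * (a * x)) (k * ((a + 1) * z)) (by norm_num) le_rfl
    one_pos le_rfl hlow hsum (by positivity) (by linarith) (by linarith) (by linarith)
  rw [hW, ← hN] at hb
  have hcard2 : (𝓡.card : ℝ) ≤ 2 := by
    exact_mod_cast (Finset.card_le_two : ({k * a - 1, k * (a + 1) - 1} : Finset ℕ).card ≤ 2)
  have hfrac : 2 * (𝓡.card : ℝ) * N * (1 / (y * 1 ^ 2 * (N / 3))) ^ 4 < 1 := by
    calc 2 * (𝓡.card : ℝ) * N * (1 / (y * 1 ^ 2 * (N / 3))) ^ 4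
        ≤ 2 * 2 * N * (1 / (y * 1 ^ 2 * (N / 3))) ^ 4 := by gcongr
      _ = 324 / (N ^ 3 * y ^ 4) := by field_simp; norm_num
      _ < 1 := by
        rw [div_lt_one (by positivity)]
        have : N ^ 1 ≤ N ^ 3 := pow_le_pow_right₀ hN1' (by norm_num)
        calc 324 < N ^ 1 * y ^ 4 := by rwa [pow_one]
          _ ≤ _ := by gcongr
  have hMU : k * (a * x) ≤ k * m := by omega
  have hpos : (0 : ℝ) < ((k * m).choose (k * (a * x)) : ℝ) := by
    exact_mod_cast Nat.choose_pos hMU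
  obtain ⟨A, hA, hgood⟩ : ∃ A ∈ W.powersetCard (k * (a * x)),
      LowBad (fun S => ¬ HasPM S G) 𝓡 (2 + 1) A ∧
      LowBad (fun S => ¬ HasPM S G) 𝓡 (2 + 1) (W \ A) := by
    by_contra! hcon
    rw [Finset.filter_true_of_mem (p := fun A => ¬ (LowBad (fun S => ¬ HasPM S G) 𝓡 (2 + 1) A ∧
    LowBad (fun S => ¬ HasPM S G) 𝓡 (2 + 1) (W \ A))) (fun A hA h => hcon A hA h.1 h.2),
      Finset.card_powersetCard, hW] at hb
    nlinarith
  rw [show (2 : ℝ) + 1 = 3 by norm_num] at hgood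
  obtain ⟨hAW, hAc⟩ := Finset.mem_powersetCard.1 hA
  have hPA : HasPM A G := hasPM_of_lowBad (by omega) hx2
    (by rw [hAc, ← hr₁]; ring) hm₁ hgood.1
  have hPB : HasPM (W \ A) G := hasPM_of_lowBad (by omega) hz2
    (by rw [Finset.card_sdiff_of_subset hAW, hAc, ← hsum, Nat.add_sub_cancel_left, ← hr₂]; ring)
    hm₂ hgood.2
  have := hPA.union hPB Finset.disjoint_sdiff
  rwa [Finset.union_sdiff_of_subset hAW] at this

end Tiling

section Spread

variable {α : Type*} [DecidableEq α]

/-- The matchings in `G` all of whose edges lie in `U`. -/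
def matchings (G : Finset (Finset α)) (U : Finset α) : Finset (Finset (Finset α)) :=
  G.powerset.filter fun F => (∀ e ∈ F, e ⊆ U) ∧ ∀ e ∈ F, ∀ f ∈ F, e ≠ f → Disjoint e f

/-- The perfect matchings of `U` in `G`. -/
def perfectMatchings (G : Finset (Finset α)) (U : Finset α) : Finset (Finset (Finset α)) :=
  (matchings G U).filter fun M => ∀ v ∈ U, ∃ e ∈ M, v ∈ e

/-- The weight of an `m`-edge matching in a set of `N` vertices. -/
noncomputable def matchingWeight (k : ℕ) (C : ℝ) (N m : ℕ) : ℝ :=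
  C ^ m * (N : ℝ) ^ m * ((N - k * m).factorial : ℝ) / (N.factorial : ℝ)

/-- The dual form of the existence of a well-spread distribution on perfect matchings of `U`. -/
def Spread (k : ℕ) (C : ℝ) (G : Finset (Finset α)) (U : Finset α) : Prop :=
  ∀ w : Finset (Finset α) → ℝ, (∀ F, 0 ≤ w F) → ∃ M ∈ perfectMatchings G U,
    ∑ F ∈ M.powerset, w F ≤ ∑ F ∈ matchings G U, w F * matchingWeight k C U.card F.card

lemma mem_matchings {G : Finset (Finset α)} {U : Finset α} {F : Finset (Finset α)} :
    F ∈ matchings G U ↔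
      F ⊆ G ∧ (∀ e ∈ F, e ⊆ U) ∧ ∀ e ∈ F, ∀ f ∈ F, e ≠ f → Disjoint e f := by
  simp [matchings]

lemma mem_perfectMatchings {G : Finset (Finset α)} {U : Finset α} {M : Finset (Finset α)} :
    M ∈ perfectMatchings G U ↔ M ∈ matchings G U ∧ ∀ v ∈ U, ∃ e ∈ M, v ∈ e := by
  simp [perfectMatchings]

lemma matchings_subset {G : Finset (Finset α)} {U : Finset α} {F F' : Finset (Finset α)}
    (hF : F ∈ matchings G U) (h : F' ⊆ F) : F' ∈ matchings G U := by
  rw [mem_matchings] at hF ⊢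
  exact ⟨h.trans hF.1, fun e he => hF.2.1 e (h he),
    fun e he f hf => hF.2.2 e (h he) f (h hf)⟩

lemma empty_mem_matchings (G : Finset (Finset α)) (U : Finset α) : ∅ ∈ matchings G U := by
  simp [mem_matchings]

lemma biUnion_subset_of_mem_matchings {G : Finset (Finset α)} {U : Finset α}
    {F : Finset (Finset α)} (hF : F ∈ matchings G U) : F.biUnion id ⊆ U :=
  Finset.biUnion_subset.2 (mem_matchings.1 hF).2.1

lemma card_biUnion_of_mem_matchings {k : ℕ} {G : Finset (Finset α)} {U : Finset α}
    (hG : ∀ e ∈ G, e.card = k) {F : Finset (Finset α)} (hF : F ∈ matchings G U) :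
    (F.biUnion id).card = k * F.card := by
  rw [mem_matchings] at hF
  rw [Finset.card_biUnion (t := id) hF.2.2]
  simp only [id]
  rw [Finset.sum_congr rfl fun e he => hG e (hF.1 he)]
  simp [mul_comm]

lemma mul_card_le_of_mem_matchings {k : ℕ} {G : Finset (Finset α)} {U : Finset α}
    (hG : ∀ e ∈ G, e.card = k) {F : Finset (Finset α)} (hF : F ∈ matchings G U) :
    k * F.card ≤ U.card := by
  rw [← card_biUnion_of_mem_matchings hG hF]
  exact Finset.card_le_card (biUnion_subset_of_mem_matchings hF)

lemma matchings_union {G : Finset (Finset α)} {A B : Finset α} {F₁ F₂ : Finset (Finset α)}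
    (hAB : Disjoint A B) (h₁ : F₁ ∈ matchings G A) (h₂ : F₂ ∈ matchings G B) :
    F₁ ∪ F₂ ∈ matchings G (A ∪ B) := by
  rw [mem_matchings] at *
  refine ⟨Finset.union_subset h₁.1 h₂.1, ?_, ?_⟩
  · intro e he
    rcases Finset.mem_union.1 he with he | he
    · exact (h₁.2.1 e he).trans Finset.subset_union_left
    · exact (h₂.2.1 e he).trans Finset.subset_union_right
  · intro e he f hf hef
    rcases Finset.mem_union.1 he with he | he <;> rcases Finset.mem_union.1 hf with hf | hf
    · exact h₁.2.2 e he f hf hef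
    · exact hAB.mono (h₁.2.1 e he) (h₂.2.1 f hf)
    · exact (hAB.mono (h₁.2.1 f hf) (h₂.2.1 e he)).symm
    · exact h₂.2.2 e he f hf hef

lemma perfectMatchings_union {G : Finset (Finset α)} {A B : Finset α}
    {M₁ M₂ : Finset (Finset α)} (hAB : Disjoint A B) (h₁ : M₁ ∈ perfectMatchings G A)
    (h₂ : M₂ ∈ perfectMatchings G B) : M₁ ∪ M₂ ∈ perfectMatchings G (A ∪ B) := by
  rw [mem_perfectMatchings] at *
  refine ⟨matchings_union hAB h₁.1 h₂.1, fun v hv => ?_⟩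
  rcases Finset.mem_union.1 hv with hv | hv
  · obtain ⟨e, he, hve⟩ := h₁.2 v hv
    exact ⟨e, Finset.mem_union_left _ he, hve⟩
  · obtain ⟨e, he, hve⟩ := h₂.2 v hv
    exact ⟨e, Finset.mem_union_right _ he, hve⟩

lemma disjoint_of_mem_matchings {k : ℕ} (hk : 1 ≤ k) {G : Finset (Finset α)} {A B : Finset α}
    (hG : ∀ e ∈ G, e.card = k) {F₁ F₂ : Finset (Finset α)} (hAB : Disjoint A B)
    (h₁ : F₁ ∈ matchings G A) (h₂ : F₂ ∈ matchings G B) : Disjoint F₁ F₂ := by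
  rw [mem_matchings] at *
  refine Finset.disjoint_left.2 fun e he he' => ?_
  have hd := hAB.mono (h₁.2.1 e he) (h₂.2.1 e he')
  have hc := hG e (h₁.1 he)
  rw [disjoint_self.1 hd] at hc
  simp at hc
  omega

lemma matchingWeight_nonneg {k : ℕ} {C : ℝ} (hC : 0 ≤ C) (N m : ℕ) :
    0 ≤ matchingWeight k C N m := by
  unfold matchingWeight
  positivity

lemma matchingWeight_mono {k : ℕ} {C C' : ℝ} (hC : 0 ≤ C) (h : C ≤ C') (N m : ℕ) :
    matchingWeight k C N m ≤ matchingWeight k C' N m := by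
  unfold matchingWeight
  gcongr

lemma matchingWeight_zero (k : ℕ) (C : ℝ) (N : ℕ) : matchingWeight k C N 0 = 1 := by
  simp [matchingWeight, Nat.factorial_ne_zero]

lemma Spread.mono {k : ℕ} {C C' : ℝ} (hC : 0 ≤ C) (h : C ≤ C') {G : Finset (Finset α)}
    {U : Finset α} (hU : Spread k C G U) : Spread k C' G U := by
  intro w hw
  obtain ⟨M, hM, hle⟩ := hU w hw
  refine ⟨M, hM, hle.trans (Finset.sum_le_sum fun F _ => ?_)⟩
  exact mul_le_mul_of_nonneg_left (matchingWeight_mono hC h _ _) (hw F)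

lemma spread_of_mem_perfectMatchings {k : ℕ} (hk : 1 ≤ k) {C : ℝ} {G : Finset (Finset α)}
    {U : Finset α} {M : Finset (Finset α)} (hG : ∀ e ∈ G, e.card = k)
    (hM : M ∈ perfectMatchings G U) (hC : (U.card.factorial : ℝ) ≤ C) : Spread k C G U := by
  intro w hw
  have hC1 : 1 ≤ C := le_trans (by exact_mod_cast U.card.factorial_pos) hC
  have hMm := (mem_perfectMatchings.1 hM).1
  refine ⟨M, hM, ?_⟩
  calc ∑ F ∈ M.powerset, w F
      ≤ ∑ F ∈ M.powerset, w F * matchingWeight k C U.card F.card := by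
        refine Finset.sum_le_sum fun F hF => le_mul_of_one_le_right (hw F) ?_
        rcases Nat.eq_zero_or_pos F.card with h0 | h0
        · rw [h0, matchingWeight_zero]
        · have hcard := mul_card_le_of_mem_matchings hG
            (matchings_subset hMm (Finset.mem_powerset.1 hF))
          have hU1 : 1 ≤ U.card := le_trans (Nat.mul_pos hk h0) hcard
          have hU1' : (1 : ℝ) ≤ U.card := by exact_mod_cast hU1
          unfold matchingWeight
          rw [le_div_iff₀ (by positivity), one_mul]
          calc (U.card.factorial : ℝ) ≤ C := hC
            _ = C * 1 * 1 := by ring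
            _ ≤ C ^ F.card * (U.card : ℝ) ^ F.card * ((U.card - k * F.card).factorial : ℝ) := by
              gcongr
              · exact le_self_pow₀ hC1 h0.ne'
              · exact one_le_pow₀ hU1'
              · exact_mod_cast Nat.factorial_pos _
    _ ≤ _ := Finset.sum_le_sum_of_subset_of_nonneg
        (fun F hF => matchings_subset hMm (Finset.mem_powerset.1 hF))
        (fun F _ _ => mul_nonneg (hw F) (matchingWeight_nonneg (by linarith) _ _))

lemma sum_powerset_union_le {w : Finset α → ℝ} (hw : ∀ F, 0 ≤ w F) (M₁ M₂ : Finset α) :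
    ∑ F ∈ (M₁ ∪ M₂).powerset, w F ≤
      ∑ F₁ ∈ M₁.powerset, ∑ F₂ ∈ M₂.powerset, w (F₁ ∪ F₂) := by
  rw [← Finset.sum_product']
  have hinv : ∀ F ∈ (M₁ ∪ M₂).powerset, (F ∩ M₁) ∪ (F ∩ M₂) = F := by
    intro F hF
    rw [← Finset.inter_union_distrib_left]
    exact Finset.inter_eq_left.2 (Finset.mem_powerset.1 hF)
  calc ∑ F ∈ (M₁ ∪ M₂).powerset, w F
      = ∑ x ∈ (M₁ ∪ M₂).powerset.image (fun F => (F ∩ M₁, F ∩ M₂)), w (x.1 ∪ x.2) := by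
        rw [Finset.sum_image]
        · exact Finset.sum_congr rfl fun F hF => by rw [hinv F hF]
        · intro F hF F' hF' h
          have h1 : F ∩ M₁ = F' ∩ M₁ := (Prod.ext_iff.1 h).1
          have h2 : F ∩ M₂ = F' ∩ M₂ := (Prod.ext_iff.1 h).2
          rw [← hinv F hF, ← hinv F' hF', h1, h2]
    _ ≤ _ := Finset.sum_le_sum_of_subset_of_nonneg (by
        intro x hx
        obtain ⟨F, _, rfl⟩ := Finset.mem_image.1 hx
        simp [Finset.inter_subset_right]) (fun x _ _ => hw _)

/-- Summing the product weights of the two halves of a fixed matching over all splittings. -/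
lemma sum_weight_split_le {k : ℕ} {C : ℝ} (hC : 0 ≤ C) {G : Finset (Finset α)} {U : Finset α}
    {M₁ M₂ : ℕ} (hG : ∀ e ∈ G, e.card = k) (hU : M₁ + M₂ = U.card) {F : Finset (Finset α)}
    (hF : F ∈ matchings G U) :
    ∑ F₁ ∈ F.powerset, ((U.powersetCard M₁).filter fun A =>
        F₁.biUnion id ⊆ A ∧ Disjoint ((F \ F₁).biUnion id) A).card *
        (matchingWeight k C M₁ F₁.card * matchingWeight k C M₂ (F \ F₁).card) ≤
      (U.card.choose M₁ : ℝ) * matchingWeight k C U.card F.card := by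
  have hsum : ∑ F₁ ∈ F.powerset, (M₁ : ℝ) ^ F₁.card * (M₂ : ℝ) ^ (F.card - F₁.card) =
      (U.card : ℝ) ^ F.card := by
    rw [Finset.sum_pow_mul_eq_add_pow, ← hU, Nat.cast_add]
  have hfac : (U.card.choose M₁ : ℝ) * (M₁.factorial * M₂.factorial) = U.card.factorial := by
    rw [← hU, Nat.choose_symm_add, ← Nat.add_choose_mul_factorial_mul_factorial M₁ M₂]
    push_cast
    ring
  have hch : (0 : ℝ) < U.card.choose M₁ := by exact_mod_cast Nat.choose_pos (by omega)
  calc _ ≤ ∑ F₁ ∈ F.powerset, (U.card.choose M₁ : ℝ) * (C ^ F.card *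
        ((U.card - k * F.card).factorial : ℝ) / U.card.factorial) *
          ((M₁ : ℝ) ^ F₁.card * (M₂ : ℝ) ^ (F.card - F₁.card)) := by
        refine Finset.sum_le_sum fun F₁ hF₁ => ?_
        rw [Finset.mem_powerset] at hF₁
        have h1 := matchings_subset hF hF₁
        have h2 := matchings_subset hF (Finset.sdiff_subset : F \ F₁ ⊆ F)
        set S := (U.powersetCard M₁).filter fun A =>
          F₁.biUnion id ⊆ A ∧ Disjoint ((F \ F₁).biUnion id) A with hS
        rcases S.eq_empty_or_nonempty with h0 | ⟨A, hA⟩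
        · rw [h0]
          simp only [Finset.card_empty, Nat.cast_zero, zero_mul]
          positivity
        have hij : F₁.card + (F \ F₁).card = F.card := by
          rw [Finset.card_sdiff_of_subset hF₁]
          have := Finset.card_le_card hF₁
          omega
        have hdisj : Disjoint (F₁.biUnion id) ((F \ F₁).biUnion id) := by
          simp only [hS, Finset.mem_filter] at hA
          exact hA.2.2.symm.mono_left hA.2.1
        have hcard := card_filter_subset_disjoint_le (biUnion_subset_of_mem_matchings h1)
          (biUnion_subset_of_mem_matchings h2) hdisj M₁
        rw [card_biUnion_of_mem_matchings hG h1, card_biUnion_of_mem_matchings hG h2] at hcard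
        simp only [hS, Finset.mem_filter, Finset.mem_powersetCard] at hA
        have hi : k * F₁.card ≤ M₁ := by
          rw [← card_biUnion_of_mem_matchings hG h1, ← hA.1.2]
          exact Finset.card_le_card hA.2.1
        have hj : k * (F \ F₁).card ≤ M₂ := by
          rw [← card_biUnion_of_mem_matchings hG h2]
          have : (F \ F₁).biUnion id ⊆ U \ A :=
            Finset.subset_sdiff.2 ⟨biUnion_subset_of_mem_matchings h2, hA.2.2⟩
          have := Finset.card_le_card this
          rw [Finset.card_sdiff_of_subset hA.1.1] at this
          omega
        rw [← hij, Nat.add_sub_cancel_left]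
        set i := F₁.card
        set j := (F \ F₁).card
        obtain ⟨u, hu⟩ := Nat.exists_eq_add_of_le hi
        obtain ⟨v, hv⟩ := Nat.exists_eq_add_of_le hj
        have hrest : U.card - k * i - k * j = u + v := by omega
        have hrest' : U.card - k * (i + j) = u + v := by rw [mul_add]; omega
        have e1 : M₁ - k * i = u := by omega
        have e2 : M₂ - k * j = v := by omega
        rw [hrest, e1] at hcard
        have hfac2 : ((u + v).choose u : ℝ) * (u.factorial * v.factorial) =
            (u + v).factorial := by
          rw [Nat.choose_symm_add, ← Nat.add_choose_mul_factorial_mul_factorial u v]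
          push_cast
          ring
        unfold matchingWeight
        rw [hrest', e1, e2, ← hfac, ← hfac2]
        calc (S.card : ℝ) * (C ^ i * (M₁ : ℝ) ^ i * u.factorial / M₁.factorial *
              (C ^ j * (M₂ : ℝ) ^ j * v.factorial / M₂.factorial))
            ≤ ((u + v).choose u : ℝ) * (C ^ i * (M₁ : ℝ) ^ i * u.factorial / M₁.factorial *
              (C ^ j * (M₂ : ℝ) ^ j * v.factorial / M₂.factorial)) := by
              refine mul_le_mul_of_nonneg_right ?_ (by positivity)
              exact_mod_cast hcard
          _ = _ := by
              field_simp
              ring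
    _ = _ := by
      rw [← Finset.mul_sum, hsum]
      unfold matchingWeight
      ring

/-- Averaged over all splittings of `U` into parts of sizes `M₁` and `M₂`, the product weights of
the two parts are at most the weight of `U`. -/
lemma sum_split_weight_le {k : ℕ} (hk : 1 ≤ k) {C : ℝ} (hC : 0 ≤ C) {G : Finset (Finset α)}
    {U : Finset α} {M₁ M₂ : ℕ} (hG : ∀ e ∈ G, e.card = k) (hU : M₁ + M₂ = U.card)
    {w : Finset (Finset α) → ℝ} (hw : ∀ F, 0 ≤ w F) :
    ∑ A ∈ U.powersetCard M₁, ∑ F₁ ∈ matchings G A, ∑ F₂ ∈ matchings G (U \ A),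
        w (F₁ ∪ F₂) * (matchingWeight k C M₁ F₁.card * matchingWeight k C M₂ F₂.card) ≤
      (U.card.choose M₁ : ℝ) * ∑ F ∈ matchings G U, w F * matchingWeight k C U.card F.card := by
  have hstep : ∀ A ∈ U.powersetCard M₁,
      ∑ F₁ ∈ matchings G A, ∑ F₂ ∈ matchings G (U \ A),
        w (F₁ ∪ F₂) * (matchingWeight k C M₁ F₁.card * matchingWeight k C M₂ F₂.card) ≤
      ∑ F ∈ matchings G U, ∑ F₁ ∈ F.powerset,
        if F₁.biUnion id ⊆ A ∧ Disjoint ((F \ F₁).biUnion id) A then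
          w F * (matchingWeight k C M₁ F₁.card * matchingWeight k C M₂ (F \ F₁).card) else 0 := by
    intro A hA
    obtain ⟨hAU, _⟩ := Finset.mem_powersetCard.1 hA
    rw [← Finset.sum_product', ← Finset.sum_sigma (matchings G U) (fun F => F.powerset)
      (fun x => if x.2.biUnion id ⊆ A ∧ Disjoint ((x.1 \ x.2).biUnion id) A then
          w x.1 * (matchingWeight k C M₁ x.2.card * matchingWeight k C M₂ (x.1 \ x.2).card)
          else 0)]
    have hdis : ∀ x ∈ matchings G A ×ˢ matchings G (U \ A), (x.1 ∪ x.2) \ x.1 = x.2 := by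
      intro x hx
      rw [Finset.mem_product] at hx
      exact Finset.union_sdiff_cancel_left
        (disjoint_of_mem_matchings hk hG Finset.disjoint_sdiff hx.1 hx.2)
    let i : Finset (Finset α) × Finset (Finset α) →
      (_ : Finset (Finset α)) × Finset (Finset α) := fun x => ⟨x.1 ∪ x.2, x.1⟩
    have hinj : Set.InjOn i (matchings G A ×ˢ matchings G (U \ A) : Finset _) := by
      intro x hx x' hx' h
      have h2 : x.1 = x'.1 := congrArg Sigma.snd h
      have h1 : x.1 ∪ x.2 = x'.1 ∪ x'.2 := congrArg Sigma.fst h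
      refine Prod.ext h2 ?_
      rw [← hdis x hx, ← hdis x' hx', h1, h2]
    calc _ = ∑ x ∈ (matchings G A ×ˢ matchings G (U \ A)).image i,
          (if x.2.biUnion id ⊆ A ∧ Disjoint ((x.1 \ x.2).biUnion id) A then
          w x.1 * (matchingWeight k C M₁ x.2.card * matchingWeight k C M₂ (x.1 \ x.2).card)
          else 0) := by
          rw [Finset.sum_image hinj]
          refine Finset.sum_congr rfl fun x hx => ?_
          have hd := hdis x hx
          rw [Finset.mem_product] at hx
          simp only [i]
          rw [hd, if_pos]
          refine ⟨biUnion_subset_of_mem_matchings hx.1, ?_⟩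
          exact Finset.disjoint_of_subset_left (biUnion_subset_of_mem_matchings hx.2)
            Finset.sdiff_disjoint
      _ ≤ _ := by
          refine Finset.sum_le_sum_of_subset_of_nonneg ?_ ?_
          · intro y hy
            obtain ⟨x, hx, rfl⟩ := Finset.mem_image.1 hy
            rw [Finset.mem_product] at hx
            rw [Finset.mem_sigma, Finset.mem_powerset]
            refine ⟨?_, Finset.subset_union_left⟩
            have := matchings_union Finset.disjoint_sdiff hx.1 hx.2
            rwa [Finset.union_sdiff_of_subset hAU] at this
          · intro y _ _
            split_ifs
            · exact mul_nonneg (hw _) (mul_nonneg (matchingWeight_nonneg hC _ _)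
                (matchingWeight_nonneg hC _ _))
            · exact le_rfl
  refine (Finset.sum_le_sum hstep).trans ?_
  rw [Finset.sum_comm, Finset.mul_sum]
  refine Finset.sum_le_sum fun F hF => ?_
  rw [Finset.sum_comm]
  calc _ = w F * ∑ F₁ ∈ F.powerset, ((U.powersetCard M₁).filter fun A =>
        F₁.biUnion id ⊆ A ∧ Disjoint ((F \ F₁).biUnion id) A).card *
        (matchingWeight k C M₁ F₁.card * matchingWeight k C M₂ (F \ F₁).card) := by
        rw [Finset.mul_sum]
        refine Finset.sum_congr rfl fun F₁ _ => ?_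
        rw [← Finset.sum_filter, Finset.sum_const, nsmul_eq_mul]
        ring
    _ ≤ w F * ((U.card.choose M₁ : ℝ) * matchingWeight k C U.card F.card) :=
        mul_le_mul_of_nonneg_left (sum_weight_split_le hC hG hU hF) (hw F)
    _ = _ := by ring

/-- If most splittings of `U` have both parts spread, then `U` is spread. -/
lemma spread_of_split {k : ℕ} (hk : 1 ≤ k) {C δ : ℝ} (hC : 0 ≤ C) (hδ0 : 0 ≤ δ) (hδ1 : δ < 1)
    {G : Finset (Finset α)} {U : Finset α} {M₁ M₂ : ℕ} (hG : ∀ e ∈ G, e.card = k)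
    (hU : M₁ + M₂ = U.card) {good : Finset α → Prop} [DecidablePred good]
    (hbad : (((U.powersetCard M₁).filter fun A => ¬ good A).card : ℝ) ≤ δ * U.card.choose M₁)
    (hgood : ∀ A ∈ U.powersetCard M₁, good A → Spread k C G A ∧ Spread k C G (U \ A)) :
    Spread k (C / (1 - δ)) G U := by
  intro w' hw'
  have hδ : 0 < 1 - δ := by linarith
  set w : Finset (Finset α) → ℝ := fun F => if F = ∅ then 0 else w' F with hwdef
  have hw : ∀ F, 0 ≤ w F := fun F => by
    simp only [hwdef]
    split_ifs
    exacts [le_rfl, hw' F]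
  set Φ := ∑ F ∈ matchings G U, w F * matchingWeight k C U.card F.card with hΦ
  set Ψ : Finset α → ℝ := fun A => ∑ F₁ ∈ matchings G A, ∑ F₂ ∈ matchings G (U \ A),
    w (F₁ ∪ F₂) * (matchingWeight k C M₁ F₁.card * matchingWeight k C M₂ F₂.card) with hΨ
  have hch : (0 : ℝ) < U.card.choose M₁ := by exact_mod_cast Nat.choose_pos (by omega)
  have hΨ0 : ∀ A, 0 ≤ Ψ A := fun A => Finset.sum_nonneg fun _ _ => Finset.sum_nonneg fun _ _ =>
    mul_nonneg (hw _) (mul_nonneg (matchingWeight_nonneg hC _ _) (matchingWeight_nonneg hC _ _))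
  have hgoodcard : (1 - δ) * U.card.choose M₁ ≤ ((U.powersetCard M₁).filter good).card := by
    have h := Finset.card_filter_add_card_filter_not (s := U.powersetCard M₁) good
    rw [Finset.card_powersetCard] at h
    have h' : (((U.powersetCard M₁).filter good).card : ℝ) +
      ((U.powersetCard M₁).filter fun A => ¬ good A).card = U.card.choose M₁ := by
      exact_mod_cast h
    linarith
  have hpos : 0 < (((U.powersetCard M₁).filter good).card : ℝ) :=
    lt_of_lt_of_le (by positivity) hgoodcard
  obtain ⟨A, hA, hΨA⟩ : ∃ A ∈ (U.powersetCard M₁).filter good, Ψ A ≤ Φ / (1 - δ) := by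
    by_contra! hcon
    have hne : ((U.powersetCard M₁).filter good).Nonempty := by
      rw [← Finset.card_pos]
      exact_mod_cast hpos
    have hΦ0 : 0 ≤ Φ := Finset.sum_nonneg fun F _ =>
      mul_nonneg (hw F) (matchingWeight_nonneg hC _ _)
    have h1 := Finset.sum_lt_sum_of_nonempty hne hcon
    rw [Finset.sum_const, nsmul_eq_mul] at h1
    have h2 : ∑ A ∈ (U.powersetCard M₁).filter good, Ψ A ≤ ∑ A ∈ U.powersetCard M₁, Ψ A :=
      Finset.sum_le_sum_of_subset_of_nonneg (Finset.filter_subset _ _) fun A _ _ => hΨ0 A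
    have h3 := sum_split_weight_le hk hC hG hU hw
    have h4 : (1 - δ) * U.card.choose M₁ * (Φ / (1 - δ)) = U.card.choose M₁ * Φ := by
      field_simp
    have h5 : (1 - δ) * U.card.choose M₁ * (Φ / (1 - δ)) ≤
        ((U.powersetCard M₁).filter good).card * (Φ / (1 - δ)) := by gcongr
    linarith
  obtain ⟨hAM, hgA⟩ := Finset.mem_filter.1 hA
  obtain ⟨hAU, hAc⟩ := Finset.mem_powersetCard.1 hAM
  have hBc : (U \ A).card = M₂ := by
    rw [Finset.card_sdiff_of_subset hAU]
    omega
  obtain ⟨hs1, hs2⟩ := hgood A hAM hgA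
  obtain ⟨P₁, hP₁, hle1⟩ := hs1
    (fun F₁ => ∑ F₂ ∈ matchings G (U \ A), w (F₁ ∪ F₂) * matchingWeight k C M₂ F₂.card)
    (fun F₁ => Finset.sum_nonneg fun F₂ _ => mul_nonneg (hw _) (matchingWeight_nonneg hC _ _))
  obtain ⟨P₂, hP₂, hle2⟩ := hs2 (fun F₂ => ∑ F₁ ∈ P₁.powerset, w (F₁ ∪ F₂))
    (fun F₂ => Finset.sum_nonneg fun F₁ _ => hw _)
  have hPM := perfectMatchings_union Finset.disjoint_sdiff hP₁ hP₂
  rw [Finset.union_sdiff_of_subset hAU] at hPM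
  refine ⟨P₁ ∪ P₂, hPM, ?_⟩
  have hsum : ∑ F ∈ (P₁ ∪ P₂).powerset, w F ≤ Φ / (1 - δ) := by
    calc ∑ F ∈ (P₁ ∪ P₂).powerset, w F
        ≤ ∑ F₁ ∈ P₁.powerset, ∑ F₂ ∈ P₂.powerset, w (F₁ ∪ F₂) := sum_powerset_union_le hw _ _
      _ = ∑ F₂ ∈ P₂.powerset, ∑ F₁ ∈ P₁.powerset, w (F₁ ∪ F₂) := Finset.sum_comm
      _ ≤ _ := hle2
      _ = ∑ F₁ ∈ P₁.powerset, ∑ F₂ ∈ matchings G (U \ A),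
            w (F₁ ∪ F₂) * matchingWeight k C M₂ F₂.card := by
          rw [hBc, Finset.sum_comm]
          exact Finset.sum_congr rfl fun F₂ _ => Finset.sum_mul _ _ _
      _ ≤ _ := hle1
      _ = Ψ A := by
          rw [hAc]
          refine Finset.sum_congr rfl fun F₁ _ => ?_
          rw [Finset.sum_mul]
          exact Finset.sum_congr rfl fun F₂ _ => by ring
      _ ≤ _ := hΨA
  have hΦle : Φ / (1 - δ) ≤
      ∑ F ∈ matchings G U, w F * matchingWeight k (C / (1 - δ)) U.card F.card := by
    rw [hΦ, Finset.sum_div]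
    refine Finset.sum_le_sum fun F _ => ?_
    rcases F.eq_empty_or_nonempty with rfl | hne
    · simp [hwdef]
    rw [mul_div_assoc]
    refine mul_le_mul_of_nonneg_left ?_ (hw F)
    have h1 : (1 - δ) ^ F.card ≤ 1 - δ :=
      pow_le_of_le_one hδ.le (by linarith) (Finset.card_pos.2 hne).ne'
    unfold matchingWeight
    rw [div_pow]
    calc C ^ F.card * (U.card : ℝ) ^ F.card * ((U.card - k * F.card).factorial : ℝ) /
          U.card.factorial / (1 - δ)
        ≤ C ^ F.card * (U.card : ℝ) ^ F.card * ((U.card - k * F.card).factorial : ℝ) /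
          U.card.factorial / (1 - δ) ^ F.card := by gcongr
      _ = _ := by ring
  have hins : ∀ (s : Finset (Finset (Finset α))) (g : Finset (Finset α) → ℝ), ∅ ∈ s →
      ∑ F ∈ s, w' F * g F = w' ∅ * g ∅ + ∑ F ∈ s, w F * g F := by
    intro s g hs
    rw [← Finset.add_sum_erase s _ hs, ← Finset.add_sum_erase s (fun F => w F * g F) hs]
    simp only [hwdef, if_true, zero_mul, zero_add]
    congr 1
    exact Finset.sum_congr rfl fun F hF => by rw [if_neg (Finset.ne_of_mem_erase hF)]
  rw [hins _ _ (empty_mem_matchings G U), Finset.card_empty, matchingWeight_zero]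
  have h0 := hins (P₁ ∪ P₂).powerset (fun _ => 1) (Finset.empty_mem_powerset _)
  simp only [mul_one] at h0
  rw [h0]
  linarith

end Spread

section Recursion

lemma perfectMatchings_nonempty_of_hasPM {n : ℕ} {U : Finset (Fin n)}
    {G : Finset (Finset (Fin n))} (h : HasPM U G) : ∃ M, M ∈ perfectMatchings G U := by
  obtain ⟨M, h1, h2, h3, h4⟩ := h
  exact ⟨M, mem_perfectMatchings.2 ⟨mem_matchings.2 ⟨h1, h2, h3⟩, h4⟩⟩

/-- The failure probability at scale `j` decays geometrically. -/
lemma split_failure_le {y k N R : ℝ} {c j : ℕ} (hy : 0 < y) (hk : 0 < k) (hc : c ≤ 2)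
    (hR1 : 1 ≤ R) (hR : 12800000000 * k / y ^ 4 ≤ R) (hN : N ≤ k * (R * 2 ^ (j + 2))) :
    2 * (c : ℝ) * N * (1 / (y * ((9 / 10 : ℝ) ^ j / 10) ^ 2 * (R * 2 ^ j))) ^ 4 ≤
      (1 / 2) ^ j / 8 := by
  have hc' : (c : ℝ) ≤ 2 := by exact_mod_cast hc
  have hR0 : 0 < R := by linarith
  have h162 : ((9 / 10 : ℝ) ^ j) ^ 2 * 2 ^ j = (81 / 50) ^ j := by
    rw [← pow_mul, mul_comm j 2, pow_mul, ← mul_pow]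
    norm_num
  have hE : y * ((9 / 10 : ℝ) ^ j / 10) ^ 2 * (R * 2 ^ j) = y * R * (81 / 50) ^ j / 100 := by
    rw [← h162]
    ring
  have hpow : (4 : ℝ) ^ j ≤ ((81 / 50) ^ j) ^ 4 := by
    rw [← pow_mul, mul_comm j 4, pow_mul]
    exact pow_le_pow_left₀ (by norm_num) (by norm_num) j
  have h4 : (4 : ℝ) ^ j = 2 ^ j * 2 ^ j := by rw [← mul_pow]; norm_num
  have hR3 : 12800000000 * k ≤ y ^ 4 * R ^ 3 := by
    rw [div_le_iff₀ (by positivity)] at hR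
    have : R ^ 1 ≤ R ^ 3 := pow_le_pow_right₀ hR1 (by norm_num)
    nlinarith [pow_pos hy 4]
  rw [hE]
  calc 2 * (c : ℝ) * N * (1 / (y * R * (81 / 50) ^ j / 100)) ^ 4
      ≤ 2 * 2 * (k * (R * 2 ^ (j + 2))) * (1 / (y * R * (81 / 50) ^ j / 100)) ^ 4 := by
        refine mul_le_mul_of_nonneg_right ?_ (by positivity)
        calc 2 * (c : ℝ) * N ≤ 2 * c * (k * (R * 2 ^ (j + 2))) := by gcongr
          _ ≤ _ := by gcongr
    _ = 1600000000 * k * 2 ^ j / (y ^ 4 * R ^ 3 * ((81 / 50) ^ j) ^ 4) := by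
        field_simp
        ring
    _ ≤ 1600000000 * k * 2 ^ j / (12800000000 * k * 4 ^ j) := by gcongr
    _ = (1 / 2) ^ j / 8 := by
        rw [h4, one_div, inv_pow]
        field_simp
        norm_num

/-- Sets in which almost all small sets through each vertex have perfect matchings are spread. -/
lemma exists_spread_const {k a : ℕ} (hk : 2 ≤ k) (ha : 5 ≤ a) :
    ∃ (C : ℝ) (R : ℕ), 1 ≤ C ∧ ∀ (n m : ℕ) (G : Finset (Finset (Fin n))) (W : Finset (Fin n)),
      IsHG k n G → R ≤ m → W.card = k * m →
      LowBad (fun S => ¬ HasPM S G) {k * a - 1, k * (a + 1) - 1} 1 W → Spread k C G W := by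
  classical
  set 𝓡 : Finset ℕ := {k * a - 1, k * (a + 1) - 1} with h𝓡
  have hcard2 : 𝓡.card ≤ 2 := Finset.card_le_two
  obtain ⟨R₀, hR₀⟩ := exists_hasPM_const (k := k) (a := a) hk ha
  obtain ⟨y, hy, hsplit⟩ := exists_split_const 𝓡 (by
    have hka : 10 ≤ k * a := by nlinarith
    have hka' : k * a ≤ k * (a + 1) := by gcongr; omega
    intro r hr
    simp only [h𝓡, Finset.mem_insert, Finset.mem_singleton] at hr
    omega)
  obtain ⟨R₁, hR₁⟩ := exists_nat_ge (10 / y + 12800000000 * (k : ℝ) / y ^ 4)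
  set R := R₀ + R₁ + 1 with hR
  have hRR₁ : (R₁ : ℝ) ≤ R := by exact_mod_cast (by omega : R₁ ≤ R)
  have hR1 : (1 : ℝ) ≤ R := by exact_mod_cast (by omega : 1 ≤ R)
  have hy10 : 0 < 10 / y := by positivity
  have hyk : 0 ≤ 12800000000 * (k : ℝ) / y ^ 4 := by positivity
  set C₀ : ℝ := ((k * (2 * R)).factorial : ℝ) with hC₀
  have hC₀1 : 1 ≤ C₀ := Nat.one_le_cast.2 (Nat.factorial_pos _)
  have main : ∀ j : ℕ, ∀ (n m : ℕ) (G : Finset (Finset (Fin n))) (W : Finset (Fin n)),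
      IsHG k n G → R * 2 ^ j ≤ m → m ≤ R * 2 ^ (j + 1) → W.card = k * m →
      LowBad (fun S => ¬ HasPM S G) 𝓡 (1 + (9 / 10) ^ j) W →
      Spread k (C₀ * (2 - (1 / 2) ^ j)) G W := by
    intro j
    induction j with
    | zero =>
      intro n m G W hG hm hm' hW hlow
      simp only [pow_zero, mul_one, zero_add, pow_one] at hm hm' hlow ⊢
      obtain ⟨M, hM⟩ := perfectMatchings_nonempty_of_hasPM
        (hR₀ n m G W (by omega) hW (by rwa [show (1 : ℝ) + 1 = 2 by norm_num] at hlow))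
      refine spread_of_mem_perfectMatchings (by omega) hG hM ?_
      rw [show (2 : ℝ) - 1 = 1 by norm_num, mul_one, hC₀, hW]
      exact_mod_cast Nat.factorial_le (Nat.mul_le_mul_left k (by omega))
    | succ j ih =>
      intro n m G W hG hm hm' hW hlow
      rw [pow_succ] at hm hm'
      have hj2 : R * 2 ^ (j + 1) = 2 * (R * 2 ^ j) := by ring
      have hlo : R * 2 ^ j ≤ m / 2 := by
        rw [Nat.le_div_iff_mul_le (by norm_num)]
        linarith
      have hhi : m - m / 2 ≤ R * 2 ^ (j + 1) := by
        rw [← mul_assoc] at hm'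
        omega
      have hx0 : (0 : ℝ) < (1 / 2) ^ j := by positivity
      have hx1 : (1 / 2 : ℝ) ^ j ≤ 1 := pow_le_one₀ (by norm_num) (by norm_num)
      have hρ0 : (0 : ℝ) < (9 / 10) ^ j := by positivity
      have hρ1 : (9 / 10 : ℝ) ^ j ≤ 1 := pow_le_one₀ (by norm_num) (by norm_num)
      have hb : (1 : ℝ) + (9 / 10) ^ (j + 1) + (9 / 10) ^ j / 10 = 1 + (9 / 10) ^ j := by
        rw [pow_succ]; ring
      have hkm : k * (m / 2) + k * (m - m / 2) = W.card := by
        rw [← mul_add, hW]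
        congr 1
        omega
      have hMle : ∀ t : ℕ, R * 2 ^ j ≤ t → ((R : ℝ) * 2 ^ j) ≤ ((k * t : ℕ) : ℝ) := by
        intro t ht
        exact_mod_cast ht.trans (Nat.le_mul_of_pos_left t (by omega))
      have hs := hsplit (fun S => ¬ HasPM S G) W (1 + (9 / 10) ^ (j + 1)) ((9 / 10) ^ j / 10)
        ((R : ℝ) * 2 ^ j) (k * (m / 2)) (k * (m - m / 2)) (by positivity)
        (by have : (9 / 10 : ℝ) ^ (j + 1) ≤ 1 := pow_le_one₀ (by norm_num) (by norm_num)
            linarith)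
        (by positivity) (by linarith) hlow hkm (by positivity) (hMle _ hlo)
        (hMle _ (by omega)) (by
          have h18 : (1 : ℝ) ≤ (9 / 5) ^ j := one_le_pow₀ (by norm_num)
          have h18' : (9 / 10 : ℝ) ^ j * 2 ^ j = (9 / 5) ^ j := by rw [← mul_pow]; norm_num
          have hyR : 10 ≤ y * R := by
            rw [← div_le_iff₀' hy]
            linarith
          calc (1 : ℝ) ≤ 10 * (9 / 5) ^ j / 10 := by linarith
            _ ≤ y * R * (9 / 5) ^ j / 10 := by gcongr
            _ = _ := by rw [← h18']; ring)
      rw [hb] at hs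
      have hN : (W.card : ℝ) ≤ k * (R * 2 ^ (j + 2)) := by
        rw [hW]
        exact_mod_cast Nat.mul_le_mul_left k (by rw [pow_succ]; exact hm')
      have hδ := split_failure_le hy (by exact_mod_cast (by omega : 0 < k)) hcard2 hR1
        (by linarith) hN
      have hsp := spread_of_split (k := k) (C := C₀ * (2 - (1 / 2) ^ j)) (δ := (1 / 2) ^ j / 8)
        (good := fun A => LowBad (fun S => ¬ HasPM S G) 𝓡 (1 + (9 / 10) ^ j) A ∧
          LowBad (fun S => ¬ HasPM S G) 𝓡 (1 + (9 / 10) ^ j) (W \ A))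
        (by omega) (mul_nonneg (by linarith) (by linarith)) (by positivity) (by linarith) hG hkm
        (hs.trans (mul_le_mul_of_nonneg_right hδ (by positivity))) (by
          intro A hA hgood
          obtain ⟨hAW, hAc⟩ := Finset.mem_powersetCard.1 hA
          refine ⟨ih n (m / 2) G A hG hlo (by omega) hAc hgood.1,
            ih n (m - m / 2) G (W \ A) hG (by omega) hhi ?_ hgood.2⟩
          rw [Finset.card_sdiff_of_subset hAW]
          omega)
      refine hsp.mono (div_nonneg (mul_nonneg (by linarith) (by linarith)) (by linarith)) ?_
      rw [div_le_iff₀ (by linarith), mul_assoc]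
      refine mul_le_mul_of_nonneg_left ?_ (by linarith)
      rw [pow_succ]
      nlinarith
  refine ⟨C₀ * 2, R, by linarith, ?_⟩
  intro n m G W hG hm hW hlow
  have hmR : m / R ≠ 0 := (Nat.div_pos hm (by omega)).ne'
  have h1 := Nat.pow_log_le_self 2 hmR
  have h2 := Nat.lt_pow_succ_log_self (b := 2) (by norm_num) (m / R)
  rw [Nat.le_div_iff_mul_le (by omega)] at h1
  rw [Nat.div_lt_iff_lt_mul (by omega), Nat.succ_eq_add_one] at h2
  have hx0 : (0 : ℝ) < (1 / 2) ^ Nat.log 2 (m / R) := by positivity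
  have hx1 : (1 / 2 : ℝ) ^ Nat.log 2 (m / R) ≤ 1 := pow_le_one₀ (by norm_num) (by norm_num)
  have hρ0 : (0 : ℝ) < (9 / 10) ^ Nat.log 2 (m / R) := by positivity
  refine (main (Nat.log 2 (m / R)) n m G W hG (by linarith) (by linarith) hW
    (hlow.mono (by linarith))).mono (mul_nonneg (by linarith) (by linarith)) ?_
  refine mul_le_mul_of_nonneg_left (by linarith) (by linarith)

end Recursion

section Threshold

lemma pow_le_exp_mul_descFactorial (j : ℕ) : ∀ N : ℕ, j ≤ N →
    (N : ℝ) ^ j ≤ Real.exp 1 ^ j * (N.descFactorial j : ℝ) := by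
  induction j with
  | zero => simp
  | succ j ih =>
    intro N hN
    obtain ⟨N, rfl⟩ : ∃ N', N = N' + 1 := ⟨N - 1, by omega⟩
    have hstep : ((N + 1 : ℕ) : ℝ) ^ j ≤ Real.exp 1 * (N : ℝ) ^ j := by
      rcases Nat.eq_zero_or_pos N with rfl | hN0
      · obtain rfl : j = 0 := by omega
        simp
      have hN0' : (0 : ℝ) < N := by exact_mod_cast hN0
      have h1 : ((N + 1 : ℕ) : ℝ) ≤ Real.exp (1 / N) * N := by
        have := Real.add_one_le_exp (1 / (N : ℝ))
        calc ((N + 1 : ℕ) : ℝ) = (1 / N + 1) * N := by push_cast; field_simp; ring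
          _ ≤ _ := by gcongr
      calc ((N + 1 : ℕ) : ℝ) ^ j ≤ (Real.exp (1 / N) * N) ^ j := by gcongr
        _ = Real.exp (j * (1 / N)) * (N : ℝ) ^ j := by rw [mul_pow, Real.exp_nat_mul]
        _ ≤ Real.exp 1 * (N : ℝ) ^ j := by
          gcongr
          rw [mul_one_div, div_le_one hN0']
          exact_mod_cast (by omega : j ≤ N)
    rw [Nat.succ_descFactorial_succ]
    calc ((N + 1 : ℕ) : ℝ) ^ (j + 1) = (N + 1 : ℕ) * ((N + 1 : ℕ) : ℝ) ^ j := by ring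
      _ ≤ (N + 1 : ℕ) * (Real.exp 1 * (Real.exp 1 ^ j * (N.descFactorial j : ℝ))) := by
        gcongr
        exact hstep.trans (by gcongr; exact ih N (by omega))
      _ = _ := by push_cast; ring

lemma matchingWeight_le {k : ℕ} (hk : 1 ≤ k) {C : ℝ} (hC : 0 ≤ C) {N m : ℕ} (hN : 0 < N)
    (h : k * m ≤ N) :
    matchingWeight k C N m ≤ (C * Real.exp 1 ^ k / (N : ℝ) ^ (k - 1)) ^ m := by
  have hN' : (0 : ℝ) < N := by exact_mod_cast hN
  have h1 := pow_le_exp_mul_descFactorial (k * m) N h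
  have h2 : ((N - k * m).factorial : ℝ) * (N.descFactorial (k * m) : ℝ) = N.factorial := by
    exact_mod_cast Nat.factorial_mul_descFactorial h
  unfold matchingWeight
  rw [div_pow, mul_pow, div_le_div_iff₀ (by positivity) (by positivity)]
  have h3 : (N : ℝ) ^ m * ((N : ℝ) ^ (k - 1)) ^ m = (N : ℝ) ^ (k * m) := by
    rw [← pow_mul, ← pow_add]
    congr 1
    obtain ⟨k, rfl⟩ : ∃ k', k = k' + 1 := ⟨k - 1, by omega⟩
    rw [Nat.add_sub_cancel]
    ring
  calc C ^ m * (N : ℝ) ^ m * ((N - k * m).factorial : ℝ) * ((N : ℝ) ^ (k - 1)) ^ m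
      = C ^ m * ((N - k * m).factorial : ℝ) * ((N : ℝ) ^ m * ((N : ℝ) ^ (k - 1)) ^ m) := by ring
    _ = C ^ m * ((N - k * m).factorial : ℝ) * (N : ℝ) ^ (k * m) := by rw [h3]
    _ ≤ C ^ m * ((N - k * m).factorial : ℝ) *
        (Real.exp 1 ^ (k * m) * (N.descFactorial (k * m) : ℝ)) := by gcongr
    _ = C ^ m * (Real.exp 1 ^ k) ^ m * N.factorial := by
      rw [← h2, pow_mul]
      ring

/-- A spread family of perfect matchings has no cheap cover. -/
lemma Spread.one_le_cover_cost {n k : ℕ} (hk : 1 ≤ k) (hn : 0 < n) {C : ℝ} (hC : 0 ≤ C)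
    {G : Finset (Finset (Fin n))} (hG : IsHG k n G) (hS : Spread k C G Finset.univ)
    (𝒢 : Finset (Finset (Finset (Fin n)))) (h𝒢 : IsCover 𝒢 (perfectMatchings G Finset.univ)) :
    1 ≤ ∑ U ∈ 𝒢, (C * Real.exp 1 ^ k / (n : ℝ) ^ (k - 1)) ^ U.card := by
  classical
  set q := C * Real.exp 1 ^ k / (n : ℝ) ^ (k - 1) with hq
  have hq0 : 0 ≤ q := by positivity
  obtain ⟨M, hM, hle⟩ := hS (fun F => if F ∈ 𝒢 then 1 else 0) (fun F => by split_ifs <;> norm_num)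
  obtain ⟨U, hU, hUM⟩ := h𝒢 M hM
  calc (1 : ℝ) = if U ∈ 𝒢 then 1 else 0 := (if_pos hU).symm
    _ ≤ ∑ F ∈ M.powerset, if F ∈ 𝒢 then (1 : ℝ) else 0 :=
      Finset.single_le_sum (f := fun F => if F ∈ 𝒢 then (1 : ℝ) else 0)
        (fun F _ => by split_ifs <;> norm_num) (Finset.mem_powerset.2 hUM)
    _ ≤ _ := hle
    _ ≤ ∑ F ∈ matchings G Finset.univ, if F ∈ 𝒢 then q ^ F.card else 0 := by
      refine Finset.sum_le_sum fun F hF => ?_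
      have hcard := mul_card_le_of_mem_matchings hG hF
      rw [Finset.card_univ, Fintype.card_fin] at hcard ⊢
      split_ifs
      · rw [one_mul]
        exact matchingWeight_le hk hC hn hcard
      · rw [zero_mul]
    _ ≤ _ := by
      rw [← Finset.sum_filter]
      refine Finset.sum_le_sum_of_subset_of_nonneg (fun F hF => (Finset.mem_filter.1 hF).2) ?_
      intro F _ _
      positivity

lemma sparsProb_hasPM {n : ℕ} (G : Finset (Finset (Fin n))) (p : ℝ) :
    sparsProb G p (fun E => HasPM Finset.univ E) =
      1 - bernExp G p (missInd (perfectMatchings G Finset.univ)) := by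
  classical
  rw [← bernExp_const G p 1, eq_sub_iff_add_eq]
  unfold sparsProb bernExp
  rw [← Finset.sum_add_distrib]
  refine Finset.sum_congr rfl fun E hE => ?_
  have hiff : HasPM Finset.univ E ↔ ∃ S ∈ perfectMatchings G Finset.univ, S ⊆ E := by
    constructor
    · rintro ⟨M, h1, h2, h3, h4⟩
      exact ⟨M, mem_perfectMatchings.2
        ⟨mem_matchings.2 ⟨h1.trans (Finset.mem_powerset.1 hE), h2, h3⟩, h4⟩, h1⟩
    · rintro ⟨M, hM, hME⟩
      obtain ⟨hM, h4⟩ := mem_perfectMatchings.1 hM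
      obtain ⟨_, h2, h3⟩ := mem_matchings.1 hM
      exact ⟨M, hME, h2, h3, h4⟩
  unfold missInd
  by_cases h : HasPM Finset.univ E
  · rw [if_pos h, if_pos (hiff.1 h)]
    ring
  · rw [if_neg h, if_neg (fun h' => h (hiff.2 h'))]
    ring

open Classical in
/-- The degree condition on the property graph in the form used for random splittings. -/
lemma card_badLink_univ_le {n r : ℕ} {G : Finset (Finset (Fin n))} {v : Fin n}
    (h : (1 - 1 / ((r + 1 : ℕ) : ℝ) ^ 2) * (((n - 1).choose r : ℕ) : ℝ) ≤
      (((Finset.powersetCard (r + 1) (Finset.univ : Finset (Fin n))).filter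
        (fun S => v ∈ S ∧ HasPM S G)).card : ℝ)) :
    ((badLink (fun S => ¬ HasPM S G) r Finset.univ v).card : ℝ) *
      (((r : ℝ) + 1) ^ 2 * (r.factorial : ℝ)) ≤ 1 * (n : ℝ) ^ r := by
  have hgood : ((Finset.powersetCard (r + 1) (Finset.univ : Finset (Fin n))).filter
      (fun S => v ∈ S ∧ HasPM S G)).card ≤
      (((Finset.univ.erase v).powersetCard r).filter fun T => HasPM (insert v T) G).card := by
    refine Finset.card_le_card_of_injOn (fun S => S.erase v) ?_ ?_
    · intro S hS
      simp only [Finset.coe_filter, Set.mem_ofPred_eq, Finset.mem_powersetCard] at hS ⊢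
      refine ⟨⟨Finset.erase_subset_erase _ (Finset.subset_univ _), ?_⟩, ?_⟩
      · rw [Finset.card_erase_of_mem hS.2.1, hS.1.2, Nat.add_sub_cancel]
      · rw [Finset.insert_erase hS.2.1]
        exact hS.2.2
    · intro S hS S' hS' hEq
      simp only [Finset.coe_filter, Set.mem_ofPred_eq] at hS hS'
      rw [← Finset.insert_erase hS.2.1, ← Finset.insert_erase hS'.2.1]
      exact congrArg (insert v) hEq
  have htot : (((Finset.univ.erase v).powersetCard r).filter fun T => HasPM (insert v T) G).card +
      (badLink (fun S => ¬ HasPM S G) r Finset.univ v).card = (n - 1).choose r := by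
    have := Finset.card_filter_add_card_filter_not (s := (Finset.univ.erase v).powersetCard r)
      (fun T => HasPM (insert v T) G)
    rw [Finset.card_powersetCard, Finset.card_erase_of_mem (Finset.mem_univ v),
      Finset.card_univ, Fintype.card_fin] at this
    rw [← this, badLink]
    congr!
  have htot' : ((((Finset.univ.erase v).powersetCard r).filter
      fun T => HasPM (insert v T) G).card : ℝ) +
      ((badLink (fun S => ¬ HasPM S G) r Finset.univ v).card : ℝ) = (n - 1).choose r := by
    exact_mod_cast htot
  have hgood' : (((Finset.powersetCard (r + 1) (Finset.univ : Finset (Fin n))).filter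
      (fun S => v ∈ S ∧ HasPM S G)).card : ℝ) ≤ ((((Finset.univ.erase v).powersetCard r).filter
      fun T => HasPM (insert v T) G).card : ℝ) := by
    exact_mod_cast hgood
  have hbad : ((badLink (fun S => ¬ HasPM S G) r Finset.univ v).card : ℝ) ≤
      1 / ((r : ℝ) + 1) ^ 2 * (n - 1).choose r := by
    push_cast at h
    linarith
  have hch : ((n - 1).choose r : ℝ) * r.factorial ≤ (n : ℝ) ^ r := by
    rw [← le_div_iff₀ (by positivity)]
    refine (Nat.choose_le_pow_div r (n - 1)).trans ?_
    gcongr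
    omega
  calc _ ≤ 1 / ((r : ℝ) + 1) ^ 2 * (n - 1).choose r *
        (((r : ℝ) + 1) ^ 2 * (r.factorial : ℝ)) := by gcongr
    _ = ((n - 1).choose r : ℝ) * r.factorial := by field_simp
    _ ≤ _ := by rwa [one_mul]

/-- A spread family of perfect matchings is hit by the random sparsification at a logarithmic
factor above the spread. -/
lemma exists_bernExp_missInd_le {k : ℕ} (hk : 2 ≤ k) {C : ℝ} (hC : 0 ≤ C) {ε : ℝ} (hε : 0 < ε) :
    ∃ n₀ : ℕ, ∀ n, n₀ ≤ n → ∀ G : Finset (Finset (Fin n)), IsHG k n G →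
      Spread k C G Finset.univ → ∀ p : ℝ, p ≤ 1 →
        129 * (C * Real.exp 1 ^ k) * (n : ℝ) ^ (-(k : ℝ) + 1) * Real.log n ≤ p →
        bernExp G p (missInd (perfectMatchings G Finset.univ)) ≤ ε := by
  obtain ⟨K, hK⟩ : ∃ K : ℕ, (1 / 16 : ℝ) ^ K < min (ε / 4) 1 :=
    exists_pow_lt_of_lt_one (by positivity) (by norm_num)
  have hK1 : 1 ≤ K := by
    rcases Nat.eq_zero_or_pos K with rfl | h
    · rw [pow_zero] at hK
      exact absurd (hK.trans_le (min_le_right _ _)) (lt_irrefl _)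
    · exact h
  have hKε : (1 / 16 : ℝ) ^ K < ε / 4 := hK.trans_le (min_le_left _ _)
  set L : ℝ := 2 ^ K * 2 / ε + 1 with hL
  have hL1 : 1 ≤ L := by
    have : 0 < 2 ^ K * 2 / ε := by positivity
    linarith
  have hKL : 2 ^ K / L ≤ ε / 2 := by
    rw [div_le_iff₀ (by linarith)]
    have : ε / 2 * L = 2 ^ K + ε / 2 := by rw [hL]; field_simp
    linarith
  obtain ⟨n₁, hn₁⟩ := exists_nat_ge (Real.exp (64 + L))
  refine ⟨n₁ + 1, ?_⟩
  intro n hn G hG hS p hp1 hp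
  have hn0 : 0 < n := by omega
  have hn0' : (0 : ℝ) < n := by exact_mod_cast hn0
  have hlog : 64 + L ≤ Real.log n := by
    rw [Real.le_log_iff_exp_le hn0']
    exact hn₁.trans (by exact_mod_cast (by omega : n₁ ≤ n))
  set q := C * Real.exp 1 ^ k / (n : ℝ) ^ (k - 1) with hq
  have hq0 : 0 ≤ q := by positivity
  set J := Nat.log 2 n + 1 with hJ
  have hnJ : n < 2 ^ J := Nat.lt_pow_succ_log_self (by norm_num) n
  have hJlog : (J : ℝ) ≤ 2 * Real.log n + 1 := by
    have h1 : ((2 ^ Nat.log 2 n : ℕ) : ℝ) ≤ n := by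
      exact_mod_cast Nat.pow_log_le_self 2 hn0.ne'
    have h2 := Real.log_le_log (by positivity) h1
    rw [Nat.cast_pow, Real.log_pow, Nat.cast_ofNat] at h2
    have h3 := Real.log_two_gt_d9
    have h4 : (0 : ℝ) ≤ Nat.log 2 n := Nat.cast_nonneg _
    rw [hJ]
    push_cast
    nlinarith
  have hrpow : (n : ℝ) ^ (-(k : ℝ) + 1) = 1 / (n : ℝ) ^ (k - 1) := by
    rw [show -(k : ℝ) + 1 = -((k - 1 : ℕ) : ℝ) by
      rw [Nat.cast_sub (by omega)]
      push_cast
      ring, Real.rpow_neg hn0'.le, Real.rpow_natCast, one_div]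
  have hJp : (64 * J + L) * q ≤ p := by
    calc (64 * J + L) * q ≤ (129 * Real.log n) * q := by gcongr; linarith
      _ = 129 * (C * Real.exp 1 ^ k) * (n : ℝ) ^ (-(k : ℝ) + 1) * Real.log n := by
        rw [hrpow, hq]
        ring
      _ ≤ p := hp
  obtain ⟨hr0, hr1⟩ := roundProb_bounds hq0 (by linarith : (0 : ℝ) ≤ L) J (hJp.trans hp1)
  have hmain := cost_mul_miss_le hq0 hL1 J (hJp.trans hp1) (perfectMatchings G Finset.univ) 1
    (K := K) (X := G)
    (fun S hS => (mem_matchings.1 (mem_perfectMatchings.1 hS).1).1)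
    (fun S hS => by
      have h := mul_card_le_of_mem_matchings hG (mem_perfectMatchings.1 hS).1
      rw [Finset.card_univ, Fintype.card_fin] at h
      calc S.card ≤ k * S.card := Nat.le_mul_of_pos_left _ (by omega)
        _ ≤ 2 ^ J := h.trans hnJ.le
        _ ≤ K * 2 ^ J := Nat.le_mul_of_pos_left _ hK1)
    (fun 𝒢 h𝒢 => hS.one_le_cover_cost (by omega) hn0 hC hG 𝒢 h𝒢)
  rw [one_mul] at hmain
  have hsix := sum_sixteenth_le hK1 J
  calc _ ≤ bernExp G (roundProb q L J) (missInd (perfectMatchings G Finset.univ)) :=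
        bernExp_anti hr0 (hr1.trans hJp) hp1 fun W W' h => missInd_anti _ h
    _ ≤ ε := by linarith

end Threshold

open Classical in
/-- **Robust perfect matchings.**  For all `k, s₀` with `s₀ ≥ 5k` there are
`C > 0` and `s₁ ≥ s₀` such that: if `G` is an `n`-vertex `k`-graph whose
property graph `P = P_{G, mat_k, s}` satisfies
`δ₁(P) ≥ (1 - s⁻²)·C(n-1, s-1)` for each `s₀ ≤ s ≤ s₁` divisible by `k`, then
`G_p` contains a perfect matching with high probability whenever
`p ≥ C n^{-k+1} log n` and `k ∣ n`. -/
theorem robust_perfect_matchings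
    (k s₀ : ℕ) (hk : 2 ≤ k) (hs₀ : 5 * k ≤ s₀) :
    ∃ C : ℝ, 0 < C ∧ ∃ s₁ : ℕ, s₀ ≤ s₁ ∧
      ∀ ε : ℝ, 0 < ε → ∃ n₀ : ℕ, ∀ n, n₀ ≤ n →
        ∀ G : Finset (Finset (Fin n)), IsHG k n G →
          (∀ s : ℕ, s₀ ≤ s → s ≤ s₁ → k ∣ s →
            ∀ v : Fin n,
              (1 - 1 / (s : ℝ) ^ 2) * (((n - 1).choose (s - 1) : ℕ) : ℝ) ≤
                (((Finset.powersetCard s (Finset.univ : Finset (Fin n))).filter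
                  (fun S => v ∈ S ∧ HasPM S G)).card : ℝ)) →
          ∀ p : ℝ, 0 ≤ p → p ≤ 1 →
            C * (n : ℝ) ^ (-(k : ℝ) + 1) * Real.log n ≤ p → k ∣ n →
            1 - ε ≤ sparsProb G p (fun E => HasPM Finset.univ E) := by
  have hs : 5 ≤ s₀ := by nlinarith
  obtain ⟨C, R, hC, hspread⟩ := exists_spread_const hk hs
  have hs₁ : s₀ ≤ k * (s₀ + 1) :=
    (Nat.le_mul_of_pos_left s₀ (by omega)).trans (Nat.mul_le_mul_left k (Nat.le_succ s₀))
  refine ⟨129 * (C * Real.exp 1 ^ k), by positivity, k * (s₀ + 1), hs₁, ?_⟩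
  intro ε hε
  obtain ⟨n₀, hn₀⟩ := exists_bernExp_missInd_le hk (zero_le_one.trans hC) hε
  refine ⟨n₀ + k * R, ?_⟩
  rintro n hn G hG hdeg p - hp1 hp ⟨m, rfl⟩
  have hRm : R ≤ m := Nat.le_of_mul_le_mul_left (by omega : k * R ≤ k * m) (by omega)
  have hlow : LowBad (fun S => ¬ HasPM S G) {k * s₀ - 1, k * (s₀ + 1) - 1} 1
      (Finset.univ : Finset (Fin (k * m))) := by
    intro r hr v _
    rw [Finset.card_univ, Fintype.card_fin]
    refine card_badLink_univ_le ?_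
    have hsk : s₀ ≤ k * s₀ := Nat.le_mul_of_pos_left s₀ (by omega)
    have hsk' : k * s₀ ≤ k * (s₀ + 1) := by gcongr; omega
    rw [Finset.mem_insert, Finset.mem_singleton] at hr
    rcases hr with hr | hr
    · obtain hr' : r + 1 = k * s₀ := by omega
      have h := hdeg (r + 1) (by omega) (by omega) (hr' ▸ Dvd.intro _ rfl) v
      rwa [Nat.add_sub_cancel] at h
    · obtain hr' : r + 1 = k * (s₀ + 1) := by omega
      have h := hdeg (r + 1) (by omega) (by omega) (hr' ▸ Dvd.intro _ rfl) v
      rwa [Nat.add_sub_cancel] at h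
  have hS := hspread (k * m) m G Finset.univ hG hRm (by rw [Finset.card_univ, Fintype.card_fin])
    hlow
  have hmiss := hn₀ (k * m) (by omega) G hG hS p hp1 hp
  rw [sparsProb_hasPM]
  linarith
end

section
/- There exists n_0 such that for all n ≥ n_0 the following holds: if C is a Hamilton cycle of the complete graph K_n chosen uniformly at random among all Hamilton cycles of K_n, then for every set of edges I ⊆ E(K_n), one has P[I ⊆ E(C)] ≤ (2e·n^{−1})^{|I|}. -/
/-- `E` is the edge set of a Hamilton cycle of the complete graph on `Fin n`:
there is a cyclic ordering `f` of all the vertices such that `E` consists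
exactly of the pairs of consecutive vertices. -/
def IsHamCycleEdgeSet (n : ℕ) (E : Finset (Finset (Fin n))) : Prop :=
  ∃ f : ℕ → Fin n, (∀ i, f (i + n) = f i) ∧ Set.InjOn f (Set.Iio n) ∧
    (∀ v : Fin n, ∃ i < n, f i = v) ∧
    E = (Finset.range n).image (fun i => ({f i, f (i + 1)} : Finset (Fin n)))

open Classical in
/-- The finite set of (edge sets of) Hamilton cycles of `K_n`. -/
noncomputable def hamCycles (n : ℕ) : Finset (Finset (Finset (Fin n))) :=
  Finset.univ.filter (fun E => IsHamCycleEdgeSet n E)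

section

open Equiv Equiv.Perm Finset

/-- On a set `S`, at most `(|S| - |A| - 1)!` cyclic permutations have prescribed values on a proper
subset `A` of `S`. -/
theorem card_cycles_agreeing_on_le {α : Type*} [Fintype α] [DecidableEq α] (S A : Finset α)
    (d : α → α) (X : Finset (Perm α)) (hAS : A ⊆ S) (hlt : A.card < S.card)
    (hX : ∀ s ∈ X, s.IsCycle ∧ s.support = S ∧ ∀ a ∈ A, s a = d a) :
    X.card ≤ (S.card - A.card - 1).factorial := by
  obtain ⟨m, hm⟩ : ∃ m, S.card = m := ⟨_, rfl⟩
  induction m generalizing S A d X with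
  | zero => omega
  | succ m ih =>
    have step : ∀ (S A : Finset α) (d : α → α) (X : Finset (Perm α)), S.card = m + 1 →
        A ⊆ S → A.card < S.card → A.Nonempty →
        (∀ s ∈ X, s.IsCycle ∧ s.support = S ∧ ∀ a ∈ A, s a = d a) →
        X.card ≤ (S.card - A.card - 1).factorial := by
      intro S A d X hm hAS hlt ⟨a, ha⟩ hX
      by_cases h2 : S.card ≤ 2
      · refine le_trans (card_le_one.2 fun s hs t ht => ?_) (Nat.factorial_pos _)
        have hs2 : ∀ s ∈ X, s = swap a (d a) := by
          intro s hs
          obtain ⟨hc, hS, hd⟩ := hX s hs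
          have h3 : s.support.card = 2 :=
            le_antisymm (hS ▸ h2) (two_le_card_support_of_ne_one hc.ne_one)
          obtain ⟨x, y, hxy, rfl⟩ := card_support_eq_two.1 h3
          rw [← hd a ha]
          have := hAS ha
          rw [← hS, support_swap hxy, mem_insert, mem_singleton] at this
          rcases this with rfl | rfl
          · simp
          · simp [swap_comm]
        rw [hs2 s hs, hs2 t ht]
      · have key : (X.image fun s => swap a (d a) * s).card ≤
            ((S.erase a).card - (A.erase a).card - 1).factorial := by
          refine ih (S.erase a) (A.erase a) (fun x => swap a (d a) (d x)) _ ?_ ?_ ?_ ?_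
          · exact erase_subset_erase _ hAS
          · rw [card_erase_of_mem (hAS ha), card_erase_of_mem ha]
            have := card_pos.2 ⟨a, ha⟩
            omega
          · intro t ht
            obtain ⟨s, hs, rfl⟩ := mem_image.1 ht
            obtain ⟨hc, hS, hd⟩ := hX s hs
            have hne : s a ≠ a := mem_support.1 (hS ▸ hAS ha)
            have hne2 : s (s a) ≠ a := by
              intro h
              have h3 := hc.eq_swap_of_apply_apply_eq_self hne h
              have : s.support.card = 2 := card_support_eq_two.2 ⟨a, s a, hne.symm, h3⟩
              rw [hS] at this
              omega
            rw [← hd a ha]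
            refine ⟨hc.swap_mul hne hne2, ?_, ?_⟩
            · rw [support_swap_mul_eq _ _ hne2, hS, sdiff_singleton_eq_erase]
            · intro x hx
              simp [hd x (mem_of_mem_erase hx)]
          · rw [card_erase_of_mem (hAS ha)]; omega
        rw [card_image_of_injective _ (mul_right_injective _), card_erase_of_mem (hAS ha),
          card_erase_of_mem ha] at key
        have := card_pos.2 ⟨a, ha⟩
        convert key using 2
        omega
    rcases A.eq_empty_or_nonempty with rfl | hA
    · obtain ⟨a, ha⟩ : S.Nonempty := card_pos.1 (by omega)
      by_cases h1 : S.card = 1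
      · rw [card_eq_zero.2]
        · exact Nat.zero_le _
        · by_contra hne
          obtain ⟨s, hs⟩ := nonempty_iff_ne_empty.2 hne
          obtain ⟨hc, hS, -⟩ := hX s hs
          have := two_le_card_support_of_ne_one hc.ne_one
          rw [hS] at this
          omega
      · have hsub : X ⊆ (S.erase a).biUnion fun v => X.filter fun s => s a = v := by
          intro s hs
          obtain ⟨hc, hS, -⟩ := hX s hs
          have hne : a ∈ s.support := hS ▸ ha
          refine mem_biUnion.2 ⟨s a, mem_erase.2 ⟨mem_support.1 hne, ?_⟩, by simp [hs]⟩
          rw [← hS]; exact apply_mem_support.2 hne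
        refine (card_le_card hsub).trans
          ((card_biUnion_le_card_mul _ _ (m - 1).factorial ?_).trans ?_)
        · intro v _
          refine (step S {a} (fun _ => v) _ hm (by simpa using ha) (by simp; omega)
            (by simp) ?_).trans (by simp [hm])
          intro s hs
          obtain ⟨hs, hv⟩ := mem_filter.1 hs
          obtain ⟨hc, hS, -⟩ := hX s hs
          exact ⟨hc, hS, by simpa using hv⟩
        · rw [card_erase_of_mem ha, hm]
          obtain ⟨k, rfl⟩ : ∃ k, m = k + 1 := ⟨m - 1, by omega⟩
          simp [Nat.factorial_succ]
    · exact step S A d X hm hAS hlt hA hX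

theorem pow_mul_factorial_le (j k : ℕ) :
    ((j + k + 1 : ℕ) : ℝ) ^ k * (j.factorial : ℝ) ≤ (j + k).factorial * Real.exp 1 ^ k := by
  induction k with
  | zero => simp
  | succ k ih =>
    have hN : (0 : ℝ) < (j + k + 1 : ℕ) := by positivity
    set N : ℝ := ((j + k + 1 : ℕ) : ℝ) with hNdef
    have h1 : (N + 1) ^ (k + 1) ≤ N ^ (k + 1) * Real.exp 1 := by
      have : (1 + 1 / N) ≤ Real.exp (1 / N) := by
        have := Real.add_one_le_exp (1 / N); linarith
      have h2 : (1 + 1 / N) ^ (k + 1) ≤ Real.exp 1 := by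
        refine (pow_le_pow_left₀ (by positivity) this _).trans ?_
        rw [← Real.exp_nat_mul]
        apply Real.exp_le_exp.2
        rw [mul_one_div, div_le_one hN, hNdef]
        push_cast; linarith [(Nat.cast_nonneg j : (0 : ℝ) ≤ j)]
      have h3 : N + 1 = N * (1 + 1 / N) := by field_simp
      rw [h3, mul_pow]
      gcongr
    have h4 : ((j + (k + 1) + 1 : ℕ) : ℝ) = N + 1 := by rw [hNdef]; push_cast; ring
    have h5 : ((j + (k + 1)).factorial : ℝ) = N * (j + k).factorial := by
      rw [hNdef, ← add_assoc, Nat.factorial_succ]; push_cast; ring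
    rw [h4, h5]
    calc (N + 1) ^ (k + 1) * (j.factorial : ℝ)
        ≤ N ^ (k + 1) * Real.exp 1 * j.factorial := by gcongr
      _ = N * Real.exp 1 * (N ^ k * j.factorial) := by ring
      _ ≤ N * Real.exp 1 * ((j + k).factorial * Real.exp 1 ^ k) := by gcongr
      _ = _ := by ring

/-- The permutations of `α` consisting of a single cycle through all points. -/
def fullCycles (α : Type*) [Fintype α] [DecidableEq α] : Finset (Perm α) :=
  univ.filter fun s => s.cycleType = {Fintype.card α}

/-- The edge set of the directed graph `v ↦ s v`, with orientations forgotten. -/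
def arcEdges {α : Type*} [Fintype α] [DecidableEq α] (s : Perm α) : Finset (Finset α) :=
  univ.image fun v => {v, s v}

variable {α : Type*} [Fintype α] [DecidableEq α]

theorem mem_fullCycles {s : Perm α} :
    s ∈ fullCycles α ↔ s.IsCycle ∧ s.support = univ := by
  simp only [fullCycles, mem_filter, mem_univ, true_and]
  constructor
  · intro h
    have hc : s.IsCycle := card_cycleType_eq_one.1 (by simp [h])
    refine ⟨hc, ?_⟩
    rw [hc.cycleType, Multiset.singleton_inj] at h
    exact (card_eq_iff_eq_univ _).1 h
  · rintro ⟨hc, hs⟩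
    rw [hc.cycleType, hs, card_univ]

theorem card_fullCycles (h : 2 ≤ Fintype.card α) :
    (fullCycles α).card = (Fintype.card α - 1).factorial := by
  rw [fullCycles, card_of_cycleType_singleton h le_rfl, Nat.choose_self, mul_one]

theorem isCycleOn_of_mem_fullCycles {s : Perm α} (hs : s ∈ fullCycles α) :
    s.IsCycleOn (univ : Finset α) := by
  obtain ⟨hc, hS⟩ := mem_fullCycles.1 hs
  have := hc.isCycleOn
  rwa [← coe_support_eq_set_support, hS] at this

theorem mem_arcEdges {s : Perm α} {e : Finset α} :
    e ∈ arcEdges s ↔ ∃ v, {v, s v} = e := by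
  simp [arcEdges]

theorem card_arcEdges_le (s : Perm α) : (arcEdges s).card ≤ Fintype.card α :=
  card_image_le

theorem arcEdges_conj (g s : Perm α) :
    arcEdges (g * s * g⁻¹) = (arcEdges s).image fun e => e.image g := by
  ext e
  simp only [mem_arcEdges, mem_image]
  constructor
  · rintro ⟨v, rfl⟩
    exact ⟨_, ⟨g⁻¹ v, rfl⟩, by simp [image_insert]⟩
  · rintro ⟨_, ⟨v, rfl⟩, rfl⟩
    exact ⟨g v, by simp [image_insert]⟩

theorem card_fiber_arcEdges_le {s t : Perm α} (hs : s ∈ fullCycles α) (ht : t ∈ fullCycles α) :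
    ((fullCycles α).filter fun r => arcEdges r = arcEdges s).card ≤
      ((fullCycles α).filter fun r => arcEdges r = arcEdges t).card := by
  obtain ⟨hsc, hsS⟩ := mem_fullCycles.1 hs
  obtain ⟨htc, htS⟩ := mem_fullCycles.1 ht
  obtain ⟨g, rfl⟩ := isConj_iff.1 (hsc.isConj htc (by rw [hsS, htS]))
  refine card_le_card_of_injOn (fun r => g * r * g⁻¹) ?_ ?_
  · intro r hr
    obtain ⟨hr, hrs⟩ := mem_filter.1 hr
    refine mem_filter.2 ⟨?_, by rw [arcEdges_conj, arcEdges_conj, hrs]⟩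
    simpa [fullCycles] using hr
  · intro r _ r' _ h
    simpa using h

theorem card_filter_subset_mul_card_eq (I : Finset (Finset α)) :
    (((fullCycles α).image arcEdges).filter fun E => I ⊆ E).card * (fullCycles α).card =
      ((fullCycles α).filter fun s => I ⊆ arcEdges s).card *
        ((fullCycles α).image arcEdges).card := by
  rcases (fullCycles α).eq_empty_or_nonempty with h | ⟨s₀, hs₀⟩
  · simp [h]
  set m := ((fullCycles α).filter fun r => arcEdges r = arcEdges s₀).card with hm
  have hfib : ∀ E ∈ (fullCycles α).image arcEdges,
      ((fullCycles α).filter fun r => arcEdges r = E).card = m := by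
    intro E hE
    obtain ⟨s, hs, rfl⟩ := mem_image.1 hE
    exact le_antisymm (card_fiber_arcEdges_le hs hs₀) (card_fiber_arcEdges_le hs₀ hs)
  have h1 : (fullCycles α).card = ((fullCycles α).image arcEdges).card * m := by
    rw [card_eq_sum_card_image arcEdges, sum_congr rfl hfib, sum_const, smul_eq_mul]
  have h2 : ((fullCycles α).filter fun s => I ⊆ arcEdges s).card =
      (((fullCycles α).image arcEdges).filter fun E => I ⊆ E).card * m := by
    rw [card_eq_sum_card_fiberwise (f := arcEdges)
      (t := ((fullCycles α).image arcEdges).filter fun E => I ⊆ E)]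
    · rw [sum_congr rfl fun E hE => ?_, sum_const, smul_eq_mul]
      obtain ⟨hE, hIE⟩ := mem_filter.1 hE
      rw [← hfib E hE, filter_filter]
      congr 1
      ext r
      simp only [mem_filter]
      constructor
      · rintro ⟨h, -, h'⟩; exact ⟨h, h'⟩
      · rintro ⟨h, rfl⟩; exact ⟨h, hIE, rfl⟩
    · intro s hs
      obtain ⟨hs, hI⟩ := mem_filter.1 hs
      exact mem_filter.2 ⟨mem_image_of_mem _ hs, hI⟩
  rw [h2]
  conv_lhs => rw [h1]
  ring

theorem card_filter_subset_arcEdges_le (I : Finset (Finset α)) (hI : ∀ e ∈ I, e.card = 2)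
    (hk : I.card < Fintype.card α) :
    ((fullCycles α).filter fun s => I ⊆ arcEdges s).card ≤
      2 ^ I.card * (Fintype.card α - I.card - 1).factorial := by
  have hsub : ((fullCycles α).filter fun s => I ⊆ arcEdges s) ⊆
      (Fintype.piFinset fun e : I => e.1).biUnion fun o =>
        (fullCycles α).filter fun s => ∀ e : I, {o e, s (o e)} = e.1 := by
    intro s hs
    obtain ⟨hs, hIs⟩ := mem_filter.1 hs
    have : ∀ e : I, ∃ v, {v, s v} = e.1 := fun e => mem_arcEdges.1 (hIs e.2)
    choose o ho using this
    refine mem_biUnion.2 ⟨o, Fintype.mem_piFinset.2 fun e => ?_, mem_filter.2 ⟨hs, ho⟩⟩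
    rw [← ho e]
    simp
  refine (card_le_card hsub).trans ((card_biUnion_le_card_mul _ _
    (Fintype.card α - I.card - 1).factorial ?_).trans_eq ?_)
  · intro o _
    rcases ((fullCycles α).filter fun s => ∀ e : I, {o e, s (o e)} = e.1).eq_empty_or_nonempty
      with h | ⟨s₀, hs₀⟩
    · rw [h]; simp
    have hs₀' := (mem_filter.1 hs₀).2
    have hinj : Function.Injective o := by
      intro e e' h
      apply Subtype.ext
      rw [← hs₀' e, ← hs₀' e', h]
    have hcard : (univ.image o).card = I.card := by
      rw [card_image_of_injective _ hinj]; simp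
    have := card_cycles_agreeing_on_le univ (univ.image o) s₀
      ((fullCycles α).filter fun s => ∀ e : I, {o e, s (o e)} = e.1) (subset_univ _)
      (by rw [hcard, card_univ]; exact hk) ?_
    · rwa [hcard, card_univ] at this
    · intro s hs
      obtain ⟨hs, hse⟩ := mem_filter.1 hs
      obtain ⟨hc, hS⟩ := mem_fullCycles.1 hs
      refine ⟨hc, hS, fun a ha => ?_⟩
      obtain ⟨e, -, rfl⟩ := mem_image.1 ha
      have h := (hse e).trans (hs₀' e).symm
      have h1 : s (o e) ∈ ({o e, s₀ (o e)} : Finset α) := by rw [← h]; simp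
      have h2 : s (o e) ≠ o e := mem_support.1 (by rw [hS]; exact mem_univ _)
      simpa [h2] using h1
  · rw [Fintype.card_piFinset, prod_congr rfl fun e _ => hI e.1 e.2]
    simp

theorem apply_eq_or_apply_apply_eq {s t : Perm α} (ht : t ∈ fullCycles α)
    (h : arcEdges s = arcEdges t) (v : α) : t v = s v ∨ s (t v) = v := by
  have : ({v, t v} : Finset α) ∈ arcEdges s := h ▸ mem_arcEdges.2 ⟨v, rfl⟩
  obtain ⟨w, hw⟩ := mem_arcEdges.1 this
  have hne : t v ≠ v := mem_support.1 (by rw [(mem_fullCycles.1 ht).2]; exact mem_univ _)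
  have h1 : v ∈ ({w, s w} : Finset α) := by rw [hw]; simp
  have h2 : t v ∈ ({w, s w} : Finset α) := by rw [hw]; simp
  simp only [mem_insert, mem_singleton] at h1 h2
  rcases h1 with rfl | h1 <;> rcases h2 with h2 | h2
  · exact absurd h2 hne
  · exact Or.inl h2
  · exact Or.inr (by rw [h2, ← h1])
  · exact absurd (h2.trans h1.symm) hne

theorem eq_of_arcEdges_eq {s t : Perm α} (hα : 3 ≤ Fintype.card α) (hs : s ∈ fullCycles α)
    (ht : t ∈ fullCycles α) (h : arcEdges s = arcEdges t) {x : α} (hx : s x = t x) : s = t := by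
  have hso := isCycleOn_of_mem_fullCycles hs
  have hto := isCycleOn_of_mem_fullCycles ht
  have hts : ∀ v, t (t v) ≠ v := by
    intro v hv
    have h2 : (t ^ 2) v = v := by simpa [pow_two] using hv
    have := Nat.le_of_dvd (by norm_num) ((hto.pow_apply_eq (mem_univ v)).1 h2)
    rw [card_univ] at this
    omega
  have all : ∀ i : ℕ, s ((s ^ i) x) = t ((s ^ i) x) := by
    intro i
    induction i with
    | zero => simpa using hx
    | succ i ih =>
      rw [pow_succ', Perm.mul_apply]
      rcases apply_eq_or_apply_apply_eq ht h (s ((s ^ i) x)) with h1 | h1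
      · exact h1.symm
      · have h2 := s.injective.eq_iff.1 h1
        rw [ih] at h2
        exact absurd h2 (hts _)
  ext v
  obtain ⟨i, -, rfl⟩ := hso.exists_pow_eq (mem_univ x) (mem_univ v)
  exact all i

theorem card_filter_arcEdges_eq_le_two (hα : 3 ≤ Fintype.card α) (E : Finset (Finset α)) :
    ((fullCycles α).filter fun s => arcEdges s = E).card ≤ 2 := by
  rcases ((fullCycles α).filter fun s => arcEdges s = E).eq_empty_or_nonempty with h | ⟨s₀, hs₀⟩
  · simp [h]
  obtain ⟨hs₀', rfl⟩ := mem_filter.1 hs₀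
  obtain ⟨x⟩ : Nonempty α := Fintype.card_pos_iff.1 (by omega)
  have hval : ∀ s ∈ (fullCycles α).filter fun s => arcEdges s = arcEdges s₀,
      s x = s₀ x ∨ s (s₀ x) = x := by
    intro s hs
    exact (apply_eq_or_apply_apply_eq hs₀' (mem_filter.1 hs).2 x).imp_left Eq.symm
  refine (card_le_card_of_injOn (t := (univ : Finset Bool)) (fun s => decide (s x = s₀ x))
    (fun _ _ => mem_univ _) ?_).trans (by simp)
  intro s hs t ht hst
  have hs' := mem_filter.1 hs
  have ht' := mem_filter.1 ht
  have hE := hs'.2.trans ht'.2.symm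
  have hiff : s x = s₀ x ↔ t x = s₀ x := by simpa using hst
  by_cases h : s x = s₀ x
  · exact eq_of_arcEdges_eq hα hs'.1 ht'.1 hE (h.trans (hiff.1 h).symm)
  · exact eq_of_arcEdges_eq hα hs'.1 ht'.1 hE
      (((hval s hs).resolve_left h).trans ((hval t ht).resolve_left (mt hiff.2 h)).symm)

theorem isHamCycleEdgeSet_iff {n : ℕ} (hn : 2 ≤ n) (E : Finset (Finset (Fin n))) :
    IsHamCycleEdgeSet n E ↔ ∃ s ∈ fullCycles (Fin n), arcEdges s = E := by
  constructor
  · rintro ⟨f, hper, hinj, -, rfl⟩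
    have hbij : Function.Bijective fun i : Fin n => f i :=
      Finite.injective_iff_bijective.1 fun i j h => Fin.ext (hinj i.2 j.2 h)
    let g : Perm (Fin n) := Equiv.ofBijective _ hbij
    have hg : ∀ i : Fin n, g i = f i := fun i => rfl
    have hrot : ∀ i : Fin n, f (finRotate n i) = f (i + 1) := by
      intro i
      obtain ⟨m, rfl⟩ : ∃ m, n = m + 1 := ⟨n - 1, by omega⟩
      rw [coe_finRotate]
      split_ifs with h
      · subst h
        have := hper 0
        rw [zero_add] at this
        simp [this]
      · rfl
    have hconj : ∀ i : Fin n, (g * finRotate n * g⁻¹) (g i) = f (i + 1) := by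
      intro i
      rw [Perm.mul_apply, Perm.mul_apply, Perm.inv_def, symm_apply_apply, hg, hrot]
    refine ⟨g * finRotate n * g⁻¹, ?_, ?_⟩
    · simp [fullCycles, cycleType_finRotate_of_le hn]
    · ext e
      simp only [mem_arcEdges, mem_image, mem_range]
      constructor
      · rintro ⟨v, rfl⟩
        obtain ⟨i, rfl⟩ := g.surjective v
        exact ⟨i, i.2, by rw [hconj, hg]⟩
      · rintro ⟨i, hi, rfl⟩
        refine ⟨g ⟨i, hi⟩, ?_⟩
        rw [hconj, hg]
  · rintro ⟨s, hs, rfl⟩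
    have hso := isCycleOn_of_mem_fullCycles hs
    let x : Fin n := ⟨0, by omega⟩
    have hcard : (univ : Finset (Fin n)).card = n := by simp
    have hex : ∀ v, ∃ i < n, (s ^ i) x = v := by
      intro v
      have := hso.exists_pow_eq (mem_univ x) (mem_univ v)
      rwa [hcard] at this
    refine ⟨fun i => (s ^ i) x, ?_, ?_, hex, ?_⟩
    · intro i
      refine (hso.pow_apply_eq_pow_apply (mem_univ x)).2 ?_
      simp [Nat.ModEq]
    · intro i hi j hj h
      have := (hso.pow_apply_eq_pow_apply (mem_univ x)).1 h
      rw [hcard] at this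
      exact Nat.ModEq.eq_of_lt_of_lt this hi hj
    · ext e
      simp only [mem_arcEdges, mem_image, mem_range]
      constructor
      · rintro ⟨v, rfl⟩
        obtain ⟨i, hi, rfl⟩ := hex v
        exact ⟨i, hi, by rw [pow_succ', Perm.mul_apply]⟩
      · rintro ⟨i, -, rfl⟩
        exact ⟨(s ^ i) x, by rw [pow_succ', Perm.mul_apply]⟩

theorem hamCycles_eq_image {n : ℕ} (hn : 2 ≤ n) :
    hamCycles n = (fullCycles (Fin n)).image arcEdges := by
  ext E
  simp [hamCycles, isHamCycleEdgeSet_iff hn]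

theorem card_filter_subset_arcEdges_le_pow_mul_factorial {n : ℕ} (hn : 3 ≤ n)
    (I : Finset (Finset (Fin n))) (hI : ∀ e ∈ I, e.card = 2) :
    (((fullCycles (Fin n)).filter fun s => I ⊆ arcEdges s).card : ℝ) ≤
      (2 * Real.exp 1 * (n : ℝ)⁻¹) ^ I.card * (n - 1).factorial := by
  have hn0 : (0 : ℝ) < n := by positivity
  rw [mul_pow, mul_pow, inv_pow]
  rcases lt_trichotomy I.card n with hk | hk | hk
  · have h1 := card_filter_subset_arcEdges_le I hI (by simpa using hk)
    rw [Fintype.card_fin] at h1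
    have h2 := pow_mul_factorial_le (n - I.card - 1) I.card
    rw [show n - I.card - 1 + I.card + 1 = n by omega,
      show n - I.card - 1 + I.card = n - 1 by omega] at h2
    have h1' : (((fullCycles (Fin n)).filter fun s => I ⊆ arcEdges s).card : ℝ) ≤
      2 ^ I.card * (n - I.card - 1).factorial := by exact_mod_cast h1
    refine h1'.trans ?_
    rw [mul_assoc, mul_assoc]
    gcongr
    rw [← mul_assoc, mul_comm, ← mul_assoc, ← div_eq_mul_inv, le_div_iff₀ (by positivity)]
    linarith
  · have h1 : ((fullCycles (Fin n)).filter fun s => I ⊆ arcEdges s).card ≤ 2 := by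
      refine (card_le_card fun s hs => ?_).trans
        (card_filter_arcEdges_eq_le_two (by simpa using hn) I)
      obtain ⟨hs, hIs⟩ := mem_filter.1 hs
      refine mem_filter.2 ⟨hs, (eq_of_subset_of_card_le hIs ?_).symm⟩
      rw [hk]; simpa using card_arcEdges_le s
    have h1' : (((fullCycles (Fin n)).filter fun s => I ⊆ arcEdges s).card : ℝ) ≤ 2 := by
      exact_mod_cast h1
    refine h1'.trans ?_
    rw [hk]
    have h2 := pow_mul_factorial_le 0 (n - 1)
    rw [show 0 + (n - 1) + 1 = n by omega, zero_add, Nat.factorial_zero, Nat.cast_one,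
      mul_one] at h2
    have h3 : (2 * n : ℝ) ≤ 2 ^ n := by
      have : ∀ m : ℕ, 3 ≤ m → 2 * m ≤ 2 ^ m := by
        intro m hm
        induction m, hm using Nat.le_induction with
        | base => norm_num
        | succ m _ ih => rw [pow_succ]; omega
      exact_mod_cast this n hn
    have h4 : (1 : ℝ) ≤ Real.exp 1 := Real.one_le_exp (by norm_num)
    have h5 : Real.exp 1 ^ (n - 1) ≤ Real.exp 1 ^ n := pow_le_pow_right₀ h4 (by omega)
    have h6 : (n : ℝ) ^ n = n * n ^ (n - 1) := by
      rw [← pow_succ']; congr 1; omega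
    rw [mul_assoc, mul_comm ((n : ℝ) ^ n)⁻¹, ← mul_assoc, ← div_eq_mul_inv,
      le_div_iff₀ (by positivity), h6]
    calc 2 * ((n : ℝ) * n ^ (n - 1)) = (2 * n) * n ^ (n - 1) := by ring
      _ ≤ 2 ^ n * ((n - 1).factorial * Real.exp 1 ^ n) := by
        gcongr
        exact h2.trans (by gcongr)
      _ = _ := by ring
  · rw [card_eq_zero.2]
    · simp only [Nat.cast_zero]; positivity
    · refine filter_eq_empty_iff.2 fun s _ hIs => ?_
      have := (card_le_card hIs).trans (card_arcEdges_le s)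
      rw [Fintype.card_fin] at this
      omega

end

open Classical in
/-- **Spread of uniformly random Hamilton cycles.**  For all sufficiently
large `n`, if `C` is a uniformly random Hamilton cycle of `K_n`, then for
every set `I` of edges of `K_n` we have `P[I ⊆ E(C)] ≤ (2e/n)^{|I|}`. -/
theorem uniform_hamilton_cycle_spread :
    ∃ n₀ : ℕ, ∀ n, n₀ ≤ n →
      ∀ I : Finset (Finset (Fin n)), (∀ e ∈ I, e.card = 2) →
        (((hamCycles n).filter (fun E => I ⊆ E)).card : ℝ) / ((hamCycles n).card : ℝ)
          ≤ (2 * Real.exp 1 * (n : ℝ)⁻¹) ^ I.card := by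
  refine ⟨3, fun n hn I hI => ?_⟩
  have hmul := card_filter_subset_mul_card_eq I
  have hcard := card_fullCycles (α := Fin n) (by simp; omega)
  rw [Fintype.card_fin] at hcard
  rw [← hamCycles_eq_image (by omega), hcard] at hmul
  have hfac : (0 : ℝ) < (n - 1).factorial := by positivity
  refine div_le_of_le_mul₀ (by positivity) (by positivity) ?_
  refine le_of_mul_le_mul_right ?_ hfac
  have hmul' : (((hamCycles n).filter fun E => I ⊆ E).card : ℝ) * (n - 1).factorial =
      ((fullCycles (Fin n)).filter fun s => I ⊆ arcEdges s).card * (hamCycles n).card := by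
    exact_mod_cast hmul
  calc _ = _ := by convert hmul'
    _ ≤ (2 * Real.exp 1 * (n : ℝ)⁻¹) ^ I.card * (n - 1).factorial * (hamCycles n).card := by
      gcongr
      exact card_filter_subset_arcEdges_le_pow_mul_factorial hn I hI
    _ = _ := by ring
end
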